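/- arXiv:1710.07686 — 2 statements merged into one kernel-verified Lean document; each statement's English description precedes it below -/
import Mathlib

section
/- Assume BH(s,r) holds for some 3/2 < s < 2 and r < s'. Then for every s̃ > s the operator 𝓔 extends to a bounded operator from L^{s̃'}(ℝ²) to L^{2s̃}(ℝ³): there is a constant C with ∥𝓔f∥_{L^{2s̃}(ℝ³)} ≤ C ∥f∥_{L^{s̃'}(ℝ²)} for all f ∈ L^{s̃'}(ℝ²) (say, for all simple f, the estimate then extending by density). -/
open MeasureTheory Set

/-- The extension operator for the hyperbolic paraboloid `τ = ξ₁ξ₂` in `ℝ³`: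
`𝓔f(t,x) = ∫_{ℝ²} e^{i(tξ₁ξ₂ + x·ξ)} f(ξ) dξ`. -/
noncomputable def extOp (f : ℝ × ℝ → ℂ) (p : ℝ × ℝ × ℝ) : ℂ :=
  ∫ ξ : ℝ × ℝ,
    Complex.exp (Complex.I * (p.1 * ξ.1 * ξ.2 + p.2.1 * ξ.1 + p.2.2 * ξ.2 : ℝ)) * f ξ

/-- Characteristic function of a set, valued in `ℂ`. -/
noncomputable def chi (Ω : Set (ℝ × ℝ)) : ℝ × ℝ → ℂ := Ω.indicator fun _ => 1

/-- The axis-parallel unit square with lower-left corner `(a, b)`. -/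
def unitSq (a b : ℝ) : Set (ℝ × ℝ) := Icc a (a + 1) ×ˢ Icc b (b + 1)

/-- Bilinear hypothesis BH(s,r) with constant `A`: a bilinear adjoint restriction estimate
`∥𝓔f·𝓔g∥_{L^s} ≤ A ∥f∥_{L^r} ∥g∥_{L^r}` whenever `f, g` are supported in `1 × 1`
axis-parallel squares whose projections onto each coordinate axis are separated by a
distance between `1` and `4` (equivalently, the corners satisfy `2 ≤ |aᵢ - bᵢ| ≤ 5`). -/
def BH (s r A : ℝ) : Prop :=
  ∀ a₁ a₂ b₁ b₂ : ℝ, 2 ≤ |a₁ - b₁| → |a₁ - b₁| ≤ 5 → 2 ≤ |a₂ - b₂| → |a₂ - b₂| ≤ 5 →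
    ∀ f g : ℝ × ℝ → ℂ,
      Function.support f ⊆ unitSq a₁ a₂ → Function.support g ⊆ unitSq b₁ b₂ →
      eLpNorm (fun p => extOp f p * extOp g p) (ENNReal.ofReal s) volume ≤
        ENNReal.ofReal A * eLpNorm f (ENNReal.ofReal r) volume *
          eLpNorm g (ENNReal.ofReal r) volume


open scoped ENNReal NNReal ComplexConjugate

open scoped ENNReal NNReal

lemma fourier_exp_abs (w : ℝ) :
    ∫ v : ℝ, Complex.exp (Complex.I * (w * v : ℝ)) * (Real.exp (-|v|) : ℂ) = 2 / (1 + w ^ 2) := by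
  have h1 : ∀ v ∈ Iic (0:ℝ), Complex.exp (Complex.I * (w * v : ℝ)) * (Real.exp (-|v|) : ℂ)
      = Complex.exp ((1 + Complex.I * w) * v) := by
    intro v hv
    rw [abs_of_nonpos hv, neg_neg, Complex.ofReal_exp, ← Complex.exp_add]
    congr 1; push_cast; ring
  have h2 : ∀ v ∈ Ioi (0:ℝ), Complex.exp (Complex.I * (w * v : ℝ)) * (Real.exp (-|v|) : ℂ)
      = Complex.exp ((-1 + Complex.I * w) * v) := by
    intro v hv
    rw [abs_of_pos hv, Complex.ofReal_exp, ← Complex.exp_add]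
    congr 1; push_cast; ring
  rw [← intervalIntegral.integral_Iic_add_Ioi (b := 0)]
  · rw [setIntegral_congr_fun measurableSet_Iic h1, setIntegral_congr_fun measurableSet_Ioi h2,
      integral_exp_mul_complex_Iic (by simp), integral_exp_mul_complex_Ioi (by simp)]
    have e1 : (1 + Complex.I * w : ℂ) ≠ 0 := by
      intro h; have := congrArg Complex.re h; simp at this
    have e2 : (-1 + Complex.I * w : ℂ) ≠ 0 := by
      intro h; have := congrArg Complex.re h; simp at this
    have e3 : (1 + (w:ℂ)^2) ≠ 0 := by
      have : (1 + w^2 : ℝ) ≠ 0 := by positivity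
      exact_mod_cast this
    have hI : Complex.I ^ 2 = -1 := Complex.I_sq
    simp only [Complex.ofReal_zero, mul_zero, Complex.exp_zero]
    field_simp
    linear_combination (-2 * (w:ℂ)^2 ) * hI
  · exact (integrableOn_congr_fun h1 measurableSet_Iic).2
      (integrableOn_exp_mul_complex_Iic (by simp) _)
  · exact (integrableOn_congr_fun h2 measurableSet_Ioi).2
      (integrableOn_exp_mul_complex_Ioi (by simp) _)

/-- Cauchy (Poisson kernel) probability measure on the line. -/
noncomputable abbrev cau : Measure ℝ := ProbabilityTheory.cauchyMeasure 0 1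

lemma integrable_exp_abs : Integrable (fun v : ℝ => (Real.exp (-|v|) : ℂ)) := by
  refine Integrable.ofReal (𝕜 := ℂ) (f := fun v : ℝ => Real.exp (-|v|)) ?_
  rw [← integrableOn_univ, ← Iic_union_Ioi (a := (0:ℝ))]
  apply IntegrableOn.union
  · refine (integrableOn_congr_fun (g := fun v => Real.exp v) ?_ measurableSet_Iic).2
      (integrableOn_exp_Iic _)
    intro v hv
    simp only []
    rw [abs_of_nonpos hv, neg_neg]
  · refine (integrableOn_congr_fun (g := fun v => Real.exp (-v)) ?_ measurableSet_Ioi).2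
      (integrableOn_exp_neg_Ioi _)
    intro v hv
    simp only []
    rw [abs_of_pos hv]

lemma cau_char (θ : ℝ) :
    ∫ y, Complex.exp (Complex.I * (θ * y : ℝ)) ∂cau = (Real.exp (-|θ|) : ℂ) := by
  set f : ℝ → ℂ := fun v : ℝ => (Real.exp (-|v|) : ℂ) with hf
  have hF : FourierTransform.fourier f = fun w : ℝ => (2 / (1 + ((2 * Real.pi) * w)^2 : ℂ)) := by
    ext w
    rw [Real.fourier_eq']
    have := fourier_exp_abs (-(2 * Real.pi * w))
    push_cast at this
    rw [neg_sq] at this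
    rw [← this]
    congr 1
    ext v
    simp only [smul_eq_mul, RCLike.inner_apply, conj_trivial, hf]
    rw [Complex.ofReal_exp]
    congr 2
    · push_cast; ring
    · push_cast; ring
  have hFi : Integrable (FourierTransform.fourier f) := by
    rw [hF]
    have h := (integrable_inv_one_add_sq.comp_mul_left' (R := 2 * Real.pi)
      (by positivity)).const_mul 2
    have := h.ofReal (𝕜 := ℂ)
    refine this.congr (ae_of_all _ fun w => ?_)
    simp [div_eq_mul_inv]
  have hinv := congrFun (Continuous.fourierInv_fourier_eq (f := f)
    (by simp only [hf]; fun_prop) integrable_exp_abs hFi) θ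
  rw [Real.fourierInv_eq', hF] at hinv
  simp only [hf] at hinv
  rw [← hinv]
  have hc := Measure.integral_comp_mul_left (fun y : ℝ => Complex.exp (Complex.I * (θ * y : ℝ)) * (2 / (1 + (y:ℂ)^2))) (2 * Real.pi)
  have hl : ∀ v : ℝ, Complex.exp (↑(2 * Real.pi * inner ℝ v θ) * Complex.I) • (2 / (1 + (2 * ↑Real.pi * ↑v) ^ 2) : ℂ) =
    Complex.exp (Complex.I * (θ * (2 * Real.pi * v) : ℝ)) * (2 / (1 + ((2 * Real.pi * v : ℝ) :ℂ)^2)) := by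
    intro v
    simp only [smul_eq_mul, RCLike.inner_apply, conj_trivial]
    congr 2
    · push_cast; ring
    · push_cast; ring
  simp_rw [hl]
  rw [hc]
  unfold cau
  rw [ProbabilityTheory.cauchyMeasure_of_scale_ne_zero _ one_ne_zero]
  have : ProbabilityTheory.cauchyPDF 0 1 = fun x => ((Real.toNNReal (ProbabilityTheory.cauchyPDFReal 0 1 x) : ℝ≥0) : ℝ≥0∞) := by
    ext x; rfl
  rw [this, integral_withDensity_eq_integral_smul (by fun_prop), ← integral_smul]
  congr 1
  ext y
  have hpos := ProbabilityTheory.cauchyPDF_pos 0 (γ := 1) one_ne_zero y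
  rw [NNReal.smul_def, Real.coe_toNNReal _ hpos.le, ProbabilityTheory.cauchyPDFReal_def]
  simp only [Complex.real_smul]
  rw [abs_of_pos (by positivity)]
  push_cast
  have e3 : (1 + (y:ℂ)^2) ≠ 0 := by
      have : (1 + y^2 : ℝ) ≠ 0 := by positivity
      exact_mod_cast this
  have e4 : ((y:ℂ)^2 + 1) ≠ 0 := by rwa [add_comm]
  have e5 : (Real.pi : ℂ) ≠ 0 := by exact_mod_cast Real.pi_ne_zero
  simp only [sub_zero, one_pow]
  field_simp
  ring


lemma bessel_abs {E ι : Type*} [NormedAddCommGroup E] [InnerProductSpace ℂ E] [DecidableEq ι]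
    (S : Finset ι) (v : ι → E) (x : E) (B : ℝ) (hB : 0 ≤ B)
    (hG : ∀ m ∈ S, ∑ m' ∈ S, ‖inner ℂ (v m) (v m')‖ ≤ B) :
    ∑ m ∈ S, ‖inner ℂ (v m) x‖ ^ 2 ≤ B * ‖x‖ ^ 2 := by
  set c : ι → ℂ := fun m => inner ℂ (v m) x with hc
  set T : ℝ := ∑ m ∈ S, ‖c m‖ ^ 2 with hT
  set y : E := ∑ m ∈ S, c m • v m with hy
  have hT0 : 0 ≤ T := Finset.sum_nonneg fun _ _ => by positivity
  have h1 : inner ℂ y x = (T : ℂ) := by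
    rw [hy, sum_inner, hT]
    push_cast
    refine Finset.sum_congr rfl fun m _ => ?_
    rw [inner_smul_left]
    change conj (c m) * c m = _
    rw [mul_comm, Complex.mul_conj, Complex.normSq_eq_norm_sq]
    push_cast; rfl
  have h2 : T ≤ ‖y‖ * ‖x‖ := by
    have := norm_inner_le_norm (𝕜 := ℂ) y x
    rw [h1, Complex.norm_real, Real.norm_of_nonneg hT0] at this
    exact this
  have h3 : ‖y‖ ^ 2 ≤ B * T := by
    have e : inner ℂ y y = ∑ m ∈ S, ∑ m' ∈ S, conj (c m) * c m' * inner ℂ (v m) (v m') := by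
      rw [hy, sum_inner]
      refine Finset.sum_congr rfl fun m _ => ?_
      rw [inner_sum]
      refine Finset.sum_congr rfl fun m' _ => ?_
      rw [inner_smul_left, inner_smul_right]; ring
    have e2 : ‖y‖ ^ 2 = ‖inner ℂ y y‖ := by
      rw [inner_self_eq_norm_sq_to_K]; simp
    rw [e2, e]
    calc _ ≤ ∑ m ∈ S, ∑ m' ∈ S, ‖c m‖ * ‖c m'‖ * ‖inner ℂ (v m) (v m')‖ := by
          refine (norm_sum_le _ _).trans (Finset.sum_le_sum fun m _ => ?_)
          refine (norm_sum_le _ _).trans (Finset.sum_le_sum fun m' _ => ?_)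
          rw [norm_mul, norm_mul, RCLike.norm_conj]
      _ ≤ ∑ m ∈ S, ∑ m' ∈ S, (‖c m‖^2 / 2 * ‖inner ℂ (v m) (v m')‖ +
            ‖c m'‖^2 / 2 * ‖inner ℂ (v m') (v m)‖) := by
          refine Finset.sum_le_sum fun m _ => Finset.sum_le_sum fun m' _ => ?_
          rw [norm_inner_symm (v m') (v m), ← add_mul]
          gcongr
          nlinarith [sq_nonneg (‖c m‖ - ‖c m'‖)]
      _ = ∑ m ∈ S, ‖c m‖^2 * ∑ m' ∈ S, ‖inner ℂ (v m) (v m')‖ := by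
          simp_rw [Finset.sum_add_distrib]
          rw [Finset.sum_comm (f := fun m m' => ‖c m'‖^2 / 2 * ‖inner ℂ (v m') (v m)‖),
            ← Finset.sum_add_distrib]
          refine Finset.sum_congr rfl fun m _ => ?_
          rw [← Finset.mul_sum]; ring
      _ ≤ ∑ m ∈ S, ‖c m‖^2 * B := by
          refine Finset.sum_le_sum fun m hm => ?_
          gcongr
          exact hG m hm
      _ = B * T := by rw [← Finset.sum_mul, mul_comm]
  rcases hT0.eq_or_lt with h | h
  · change T ≤ _
    rw [← h]; positivity
  · have : T * T ≤ T * (B * ‖x‖ ^ 2) := by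
      calc T * T ≤ (‖y‖ * ‖x‖) * (‖y‖ * ‖x‖) := by gcongr
        _ = ‖y‖ ^ 2 * ‖x‖^2 := by ring
        _ ≤ B * T * ‖x‖^2 := by gcongr
        _ = _ := by ring
    exact le_of_mul_le_mul_left this h

/-- the product of two Cauchy measures -/
noncomputable abbrev mu2 : Measure (ℝ × ℝ) := cau.prod cau

/-- the modulation character -/
noncomputable def ph (d m : ℤ × ℤ) (y : ℝ × ℝ) : ℂ :=
  Complex.exp (Complex.I * ((2 * m.1 + d.1) * y.1 + (2 * m.2 + d.2) * y.2 : ℝ))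

lemma continuous_ph (d m : ℤ × ℤ) : Continuous (ph d m) := by
  unfold ph; fun_prop

lemma norm_ph (d m : ℤ × ℤ) (y : ℝ × ℝ) : ‖ph d m y‖ = 1 := by
  unfold ph
  rw [mul_comm, Complex.norm_exp_ofReal_mul_I]

lemma mu2_char (a b : ℝ) :
    ∫ y, Complex.exp (Complex.I * (a * y.1 + b * y.2 : ℝ)) ∂mu2
      = (Real.exp (-|a|) : ℂ) * (Real.exp (-|b|) : ℂ) := by
  rw [← cau_char a, ← cau_char b, ← integral_prod_mul]
  congr 1
  ext y
  rw [← Complex.exp_add]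
  congr 1
  push_cast; ring

lemma summable_kappa : Summable (fun m : ℤ × ℤ => Real.exp (-|(2 * m.1 : ℝ)|) * Real.exp (-|(2 * m.2 : ℝ)|)) := by
  have h : Summable (fun n : ℤ => Real.exp (-|(2 * n : ℝ)|)) := by
    apply Summable.of_nat_of_neg
    · have : Summable (fun n : ℕ => (Real.exp (-2)) ^ n) :=
        summable_geometric_of_lt_one (Real.exp_nonneg _) (by rw [Real.exp_lt_one_iff]; norm_num)
      refine this.congr fun n => ?_
      rw [← Real.exp_nat_mul, abs_of_nonneg (by positivity)]
      congr 1; push_cast; ring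
    · have : Summable (fun n : ℕ => (Real.exp (-2)) ^ n) :=
        summable_geometric_of_lt_one (Real.exp_nonneg _) (by rw [Real.exp_lt_one_iff]; norm_num)
      refine this.congr fun n => ?_
      rw [← Real.exp_nat_mul, abs_of_nonpos (by push_cast; nlinarith [n.cast_nonneg (α := ℝ)])]
      congr 1; push_cast; ring
  exact h.mul_of_nonneg h (fun _ => Real.exp_nonneg _) (fun _ => Real.exp_nonneg _)

/-- Bessel constant -/
noncomputable def Bc : ℝ := ∑' m : ℤ × ℤ, Real.exp (-|(2 * m.1 : ℝ)|) * Real.exp (-|(2 * m.2 : ℝ)|)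

lemma Bc_nonneg : 0 ≤ Bc := tsum_nonneg fun _ => by positivity

lemma bessel_mu (d : ℤ × ℤ) (S : Finset (ℤ × ℤ)) (h : ℝ × ℝ → ℂ) (hh : MemLp h 2 mu2) :
    ∑ m ∈ S, ‖∫ y, ph d m y * h y ∂mu2‖ ^ 2 ≤ Bc * ∫ y, ‖h y‖ ^ 2 ∂mu2 := by
  have hv : ∀ m, MemLp (fun y => conj (ph d m y)) 2 mu2 := fun m =>
    MemLp.of_bound (by
      have := continuous_ph d m
      exact (Complex.continuous_conj.comp this).aestronglyMeasurable) 1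
      (ae_of_all _ fun y => by rw [RCLike.norm_conj, norm_ph])
  have key := bessel_abs S (fun m => (hv m).toLp) hh.toLp Bc Bc_nonneg ?_
  · have e1 : ∀ m, inner ℂ (hv m).toLp hh.toLp = ∫ y, ph d m y * h y ∂mu2 := by
      intro m
      rw [L2.inner_def]
      refine integral_congr_ae ?_
      filter_upwards [(hv m).coeFn_toLp, hh.coeFn_toLp] with y h1 h2
      rw [h1, h2]
      simp [mul_comm]
    have e2 : ‖hh.toLp‖ ^ 2 = ∫ y, ‖h y‖ ^ 2 ∂mu2 := by
      have : ((‖hh.toLp‖ ^ 2 : ℝ) : ℂ) = inner ℂ hh.toLp hh.toLp := by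
        rw [inner_self_eq_norm_sq_to_K]; simp
      have h2 : inner ℂ hh.toLp hh.toLp = ((∫ y, ‖h y‖ ^ 2 ∂mu2 : ℝ) : ℂ) := by
        rw [L2.inner_def]
        refine Eq.trans ?_ (integral_ofReal (𝕜 := ℂ) (f := fun y => ‖h y‖ ^ 2))
        refine integral_congr_ae ?_
        filter_upwards [hh.coeFn_toLp] with y h2
        rw [h2, inner_self_eq_norm_sq_to_K]; simp
      rw [h2] at this
      exact_mod_cast this
    simp_rw [e1, e2] at key
    exact key
  · intro m _
    have e : ∀ m', ‖inner ℂ (hv m).toLp (hv m').toLp‖ =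
        Real.exp (-|(2 * (m - m').1 : ℝ)|) * Real.exp (-|(2 * (m - m').2 : ℝ)|) := by
      intro m'
      have : inner ℂ (hv m).toLp (hv m').toLp = ∫ y, Complex.exp (Complex.I *
          ((2 * ((m - m').1 : ℤ) : ℝ) * y.1 + (2 * ((m - m').2 : ℤ) : ℝ) * y.2 : ℝ)) ∂mu2 := by
        rw [L2.inner_def]
        refine integral_congr_ae ?_
        filter_upwards [(hv m).coeFn_toLp, (hv m').coeFn_toLp] with y h1 h2
        rw [h1, h2]
        simp only [RCLike.inner_apply, Complex.conj_conj]
        unfold ph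
        rw [← Complex.exp_conj, ← Complex.exp_add]
        congr 1
        rw [map_mul, Complex.conj_ofReal, Complex.conj_I]
        simp
        ring
      rw [this, mu2_char, norm_mul, Complex.norm_real, Complex.norm_real, Real.norm_of_nonneg (by positivity), Real.norm_of_nonneg (by positivity)]
    simp_rw [e]
    rw [← Finset.sum_image (s := S) (g := fun m' => m - m') (f := fun k : ℤ × ℤ => Real.exp (-|(2 * k.1 : ℝ)|) * Real.exp (-|(2 * k.2 : ℝ)|))]
    · exact summable_kappa.sum_le_tsum _ fun _ _ => by positivity
    · intro a _ b _ hab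
      simpa using hab


lemma jensen_rpow {α : Type*} [MeasurableSpace α] (μ : Measure α) [IsProbabilityMeasure μ]
    (g : α → ℝ≥0∞) (hg : AEMeasurable g μ) (p : ℝ) (hp : 1 ≤ p) :
    (∫⁻ y, g y ∂μ) ^ p ≤ ∫⁻ y, g y ^ p ∂μ := by
  rcases hp.eq_or_lt with rfl | hp
  · simp
  have hc := Real.HolderConjugate.conjExponent hp
  have := ENNReal.lintegral_mul_le_Lp_mul_Lq μ hc hg (g := fun _ => 1) aemeasurable_const
  simp only [Pi.mul_apply, mul_one, ENNReal.one_rpow, lintegral_const, measure_univ] at this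
  calc _ ≤ ((∫⁻ y, g y ^ p ∂μ) ^ (1 / p)) ^ p := by gcongr
    _ = _ := by rw [← ENNReal.rpow_mul, one_div_mul_cancel (by linarith), ENNReal.rpow_one]

/-- dual operator -/
noncomputable def Tm (d m : ℤ × ℤ) (h : ℝ × ℝ → ℂ) (x : ℝ × ℝ) : ℂ :=
  ∫ y, ph d m y * h (x + y) ∂mu2

lemma Tm_pointwise (d : ℤ × ℤ) (S : Finset (ℤ × ℤ)) (h : ℝ × ℝ → ℂ) (hh : Measurable h)
    (w : ℝ) (hw : 2 ≤ w) (x : ℝ × ℝ) :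
    ∑ m ∈ S, ‖Tm d m h x‖ₑ ^ w ≤ (1 + ENNReal.ofReal Bc) * ∫⁻ y, ‖h (x + y)‖ₑ ^ w ∂mu2 := by
  set Q : ℝ≥0∞ := ∫⁻ y, ‖h (x + y)‖ₑ ^ (2:ℝ) ∂mu2 with hQ
  have hm : Measurable fun y => h (x + y) := hh.comp (measurable_const_add x)
  have hJ : Q ^ (w / 2) ≤ ∫⁻ y, ‖h (x + y)‖ₑ ^ w ∂mu2 := by
    refine (jensen_rpow mu2 _ (by fun_prop) (w / 2) (by linarith)).trans (le_of_eq ?_)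
    refine lintegral_congr fun y => ?_
    rw [← ENNReal.rpow_mul]; congr 1; ring
  refine le_trans ?_ (mul_le_mul_right hJ _)
  by_cases hQt : Q = ⊤
  · rw [hQt, ENNReal.top_rpow_of_pos (by linarith), ENNReal.mul_top (by simp)]
    exact le_top
  have hL : MemLp (fun y => h (x + y)) 2 mu2 := by
    refine ⟨hm.aestronglyMeasurable, ?_⟩
    rw [eLpNorm_lt_top_iff_lintegral_rpow_enorm_lt_top (by simp) (by simp)]
    exact lt_top_iff_ne_top.2 (by simpa [hQ] using hQt)
  have hb := bessel_mu d S _ hL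
  have hInt : ENNReal.ofReal (∫ y, ‖h (x + y)‖ ^ 2 ∂mu2) = Q := by
    rw [ofReal_integral_eq_lintegral_ofReal]
    · refine lintegral_congr fun y => ?_
      rw [ENNReal.ofReal_pow (norm_nonneg _), ofReal_norm, ← ENNReal.rpow_natCast]; simp
    · exact hL.integrable_norm_pow (by norm_num)
    · exact ae_of_all _ fun _ => by positivity
  have hb2 : ∑ m ∈ S, ‖Tm d m h x‖ₑ ^ (2:ℝ) ≤ ENNReal.ofReal Bc * Q := by
    rw [← hInt, ← ENNReal.ofReal_mul Bc_nonneg]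
    refine le_trans (le_of_eq ?_) (ENNReal.ofReal_le_ofReal hb)
    rw [ENNReal.ofReal_sum_of_nonneg fun _ _ => by positivity]
    refine Finset.sum_congr rfl fun m _ => ?_
    rw [ENNReal.ofReal_pow (norm_nonneg _), ofReal_norm, ← ENNReal.rpow_natCast]; simp [Tm]
  have hT : ∀ m, ‖Tm d m h x‖ₑ ≤ Q ^ (1/2 : ℝ) := by
    intro m
    have h1 : ‖Tm d m h x‖ₑ ≤ ∫⁻ y, ‖h (x + y)‖ₑ ∂mu2 := by
      refine (enorm_integral_le_lintegral_enorm _).trans (le_of_eq (lintegral_congr fun y => ?_))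
      rw [enorm_mul, ← ofReal_norm (ph d m y), norm_ph]; simp
    have h2 := jensen_rpow mu2 (fun y => ‖h (x + y)‖ₑ) (by fun_prop) 2 (by norm_num)
    calc _ ≤ ((∫⁻ y, ‖h (x + y)‖ₑ ∂mu2) ^ (2:ℝ)) ^ (1/2:ℝ) := by
          rw [← ENNReal.rpow_mul]; simpa using h1
      _ ≤ _ := by gcongr
  calc ∑ m ∈ S, ‖Tm d m h x‖ₑ ^ w
      ≤ ∑ m ∈ S, Q ^ ((w - 2)/2) * ‖Tm d m h x‖ₑ ^ (2:ℝ) := by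
        refine Finset.sum_le_sum fun m _ => ?_
        have : w = (w - 2) + 2 := by ring
        conv_lhs => rw [this]
        rw [ENNReal.rpow_add_of_nonneg _ _ (by linarith) (by norm_num)]
        gcongr
        calc _ ≤ (Q ^ (1/2:ℝ)) ^ (w - 2) := ENNReal.rpow_le_rpow (hT m) (by linarith)
          _ = _ := by rw [← ENNReal.rpow_mul]; congr 1; ring
    _ = Q ^ ((w - 2)/2) * ∑ m ∈ S, ‖Tm d m h x‖ₑ ^ (2:ℝ) := by rw [Finset.mul_sum]
    _ ≤ Q ^ ((w - 2)/2) * (ENNReal.ofReal Bc * Q) := by gcongr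
    _ = ENNReal.ofReal Bc * Q ^ (w/2) := by
        have : w / 2 = (w-2)/2 + 1 := by ring
        conv_rhs => rw [this]
        rw [ENNReal.rpow_add_of_nonneg _ _ (by linarith) (by norm_num), ENNReal.rpow_one]; ring
    _ ≤ _ := by gcongr; exact le_add_self

lemma Tm_meas (d m : ℤ × ℤ) (h : ℝ × ℝ → ℂ) (hh : Measurable h) : Measurable (Tm d m h) := by
  have : StronglyMeasurable (fun q : (ℝ × ℝ) × (ℝ × ℝ) => ph d m q.2 * h (q.1 + q.2)) := by
    have := (continuous_ph d m).measurable
    exact (Measurable.mul (by fun_prop) (by fun_prop)).stronglyMeasurable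
  exact (this.integral_prod_right (ν := mu2)).measurable

lemma Tm_int (d : ℤ × ℤ) (S : Finset (ℤ × ℤ)) (h : ℝ × ℝ → ℂ) (hh : Measurable h)
    (w : ℝ) (hw : 2 ≤ w) :
    ∑ m ∈ S, ∫⁻ x, ‖Tm d m h x‖ₑ ^ w ≤ (1 + ENNReal.ofReal Bc) * ∫⁻ x, ‖h x‖ₑ ^ w := by
  rw [← lintegral_finsetSum _ fun m _ => by
    have := Tm_meas d m h hh; fun_prop]
  calc _ ≤ ∫⁻ x, (1 + ENNReal.ofReal Bc) * ∫⁻ y, ‖h (x + y)‖ₑ ^ w ∂mu2 :=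
        lintegral_mono fun x => Tm_pointwise d S h hh w hw x
    _ = (1 + ENNReal.ofReal Bc) * ∫⁻ x, ∫⁻ y, ‖h (x + y)‖ₑ ^ w ∂mu2 :=
        lintegral_const_mul' _ _ (by simp)
    _ = (1 + ENNReal.ofReal Bc) * ∫⁻ y, (∫⁻ x, ‖h (x + y)‖ₑ ^ w) ∂mu2 := by
        rw [lintegral_lintegral_swap]
        exact Measurable.aemeasurable (by simp only [Function.uncurry_def]; fun_prop)
    _ = _ := by
        congr 1
        simp_rw [lintegral_add_right_eq_self (fun x => ‖h x‖ₑ ^ w)]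
        simp

/-- the convolution operator -/
noncomputable def Gm (d m : ℤ × ℤ) (H : ℝ × ℝ → ℂ) (x : ℝ × ℝ) : ℂ :=
  ∫ y, ph d m y * H (x - y) ∂mu2

lemma Gm_meas (d m : ℤ × ℤ) (h : ℝ × ℝ → ℂ) (hh : Measurable h) : Measurable (Gm d m h) := by
  have : StronglyMeasurable (fun q : (ℝ × ℝ) × (ℝ × ℝ) => ph d m q.2 * h (q.1 - q.2)) := by
    have := (continuous_ph d m).measurable
    exact (Measurable.mul (by fun_prop) (by fun_prop)).stronglyMeasurable
  exact (this.integral_prod_right (ν := mu2)).measurable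

lemma Gm_int (d m : ℤ × ℤ) (H : ℝ × ℝ → ℂ) (hH : Measurable H) (s : ℝ) (hs : 1 ≤ s) :
    ∫⁻ x, ‖Gm d m H x‖ₑ ^ s ≤ ∫⁻ x, ‖H x‖ₑ ^ s := by
  calc _ ≤ ∫⁻ x, ∫⁻ y, ‖H (x - y)‖ₑ ^ s ∂mu2 := by
        refine lintegral_mono fun x => ?_
        refine le_trans ?_ (jensen_rpow mu2 _ (by fun_prop) s hs)
        gcongr
        refine (enorm_integral_le_lintegral_enorm _).trans (le_of_eq (lintegral_congr fun y => ?_))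
        rw [enorm_mul, ← ofReal_norm (ph d m y), norm_ph]; simp
    _ = ∫⁻ y, (∫⁻ x, ‖H (x - y)‖ₑ ^ s) ∂mu2 := by
        rw [lintegral_lintegral_swap]
        exact Measurable.aemeasurable (by simp only [Function.uncurry_def]; fun_prop)
    _ = _ := by
        simp_rw [lintegral_sub_right_eq_self (fun x => ‖H x‖ₑ ^ s)]
        simp

lemma Gm_dual (d m : ℤ × ℤ) (H h : ℝ × ℝ → ℂ) (hH : Measurable H) (hh : Measurable h)
    (s w : ℝ) (hsw : s.HolderConjugate w) (h1 : ∫⁻ x, ‖H x‖ₑ ^ s ≠ ⊤) (h2 : ∫⁻ x, ‖h x‖ₑ ^ w ≠ ⊤) :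
    ∫ x, Gm d m H x * h x = ∫ x, H x * Tm d m h x := by
  have hp := (continuous_ph d m).measurable
  have hbound : ∀ y : ℝ × ℝ, ∫⁻ x, ‖H (x - y)‖ₑ * ‖h x‖ₑ ≤
      (∫⁻ x, ‖H x‖ₑ ^ s) ^ (1/s) * (∫⁻ x, ‖h x‖ₑ ^ w) ^ (1/w) := by
    intro y
    have := ENNReal.lintegral_mul_le_Lp_mul_Lq volume hsw (f := fun x => ‖H (x - y)‖ₑ)
      (g := fun x => ‖h x‖ₑ) (by fun_prop) (by fun_prop)
    rwa [lintegral_sub_right_eq_self (fun x => ‖H x‖ₑ ^ s)] at this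
  have hfin : (∫⁻ x, ‖H x‖ₑ ^ s) ^ (1/s) * (∫⁻ x, ‖h x‖ₑ ^ w) ^ (1/w) < ⊤ :=
    ENNReal.mul_lt_top (ENNReal.rpow_lt_top_of_nonneg (by simpa using hsw.nonneg) h1)
      (ENNReal.rpow_lt_top_of_nonneg (by simpa using hsw.symm.nonneg) h2)
  have hI : Integrable (Function.uncurry fun (x y : ℝ × ℝ) => ph d m y * H (x - y) * h x)
      (volume.prod mu2) := by
    refine ⟨Measurable.aestronglyMeasurable (by simp only [Function.uncurry_def]; fun_prop), ?_⟩
    unfold HasFiniteIntegral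
    rw [lintegral_prod_symm _ (Measurable.aemeasurable
      (by simp only [Function.uncurry_def]; fun_prop))]
    refine lt_of_le_of_lt (b := ∫⁻ y, (∫⁻ x, ‖H x‖ₑ ^ s) ^ (1/s) * (∫⁻ x, ‖h x‖ₑ ^ w) ^ (1/w) ∂mu2) ?_ (by simpa using hfin)
    refine lintegral_mono fun y => ?_
    refine le_trans (le_of_eq (lintegral_congr fun x => ?_)) (hbound y)
    simp only [Function.uncurry, enorm_mul]
    rw [← ofReal_norm (ph d m y), norm_ph]; simp
  have hI2 : Integrable (Function.uncurry fun (x y : ℝ × ℝ) => ph d m y * H x * h (x + y))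
      (volume.prod mu2) := by
    refine ⟨Measurable.aestronglyMeasurable (by simp only [Function.uncurry_def]; fun_prop), ?_⟩
    unfold HasFiniteIntegral
    rw [lintegral_prod_symm _ (Measurable.aemeasurable
      (by simp only [Function.uncurry_def]; fun_prop))]
    refine lt_of_le_of_lt (b := ∫⁻ y, (∫⁻ x, ‖H x‖ₑ ^ s) ^ (1/s) * (∫⁻ x, ‖h x‖ₑ ^ w) ^ (1/w) ∂mu2) ?_ (by simpa using hfin)
    refine lintegral_mono fun y => ?_
    refine le_trans (le_of_eq ?_) (hbound y)
    rw [← lintegral_add_right_eq_self (fun x => ‖H (x - y)‖ₑ * ‖h x‖ₑ) y]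
    refine lintegral_congr fun x => ?_
    simp only [Function.uncurry, enorm_mul, add_sub_cancel_right]
    rw [← ofReal_norm (ph d m y), norm_ph]; simp
  calc _ = ∫ x, ∫ y, ph d m y * H (x - y) * h x ∂mu2 := by
        congr 1; ext x; rw [Gm, ← integral_mul_const]
    _ = ∫ y, (∫ x, ph d m y * H (x - y) * h x) ∂mu2 := integral_integral_swap hI
    _ = ∫ y, (∫ x, ph d m y * H x * h (x + y)) ∂mu2 := by
        congr 1; ext y
        rw [← integral_add_right_eq_self (fun x => ph d m y * H (x - y) * h x) y]
        simp
    _ = ∫ x, ∫ y, ph d m y * H x * h (x + y) ∂mu2 := (integral_integral_swap hI2).symm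
    _ = _ := by
        congr 1; ext x
        rw [Tm, ← integral_const_mul]
        congr 1; ext y; ring

/-- almost orthogonality in `L^s`, `1 < s ≤ 2`. -/
lemma orth (s : ℝ) (hs1 : 1 < s) (hs2 : s ≤ 2) (d : ℤ × ℤ) (S : Finset (ℤ × ℤ))
    (H : ℤ × ℤ → ℝ × ℝ → ℂ) (hH : ∀ m, Measurable (H m)) :
    ∫⁻ x, ‖∑ m ∈ S, Gm d m (H m) x‖ₑ ^ s ≤
      (1 + ENNReal.ofReal Bc) ^ (s - 1) * ∑ m ∈ S, ∫⁻ x, ‖H m x‖ₑ ^ s := by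
  set B' : ℝ≥0∞ := 1 + ENNReal.ofReal Bc with hB'
  have hB1 : 1 ≤ B' := le_self_add
  have hBt : B' ≠ ⊤ := by simp [hB']
  by_cases hX : ∑ m ∈ S, ∫⁻ x, ‖H m x‖ₑ ^ s = ⊤
  · rw [hX, ENNReal.mul_top]
    · exact le_top
    · exact (lt_of_lt_of_le one_pos (ENNReal.one_le_rpow hB1 (by linarith))).ne'
  have hXm : ∀ m ∈ S, ∫⁻ x, ‖H m x‖ₑ ^ s ≠ ⊤ := fun m hm => by
    have := ENNReal.sum_ne_top.1 hX m hm
    exact this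
  set w : ℝ := s.conjExponent with hw
  have hsw : s.HolderConjugate w := Real.HolderConjugate.conjExponent hs1
  have hw2 : 2 ≤ w := by
    rw [hw, Real.conjExponent, le_div_iff₀ (by linarith)]; linarith
  have hws : (s - 1) * w = s := by
    rw [hw, Real.conjExponent]; field_simp [(by linarith : s - 1 ≠ 0)]
  set F : ℝ × ℝ → ℂ := fun x => ∑ m ∈ S, Gm d m (H m) x with hF
  have hGmeas : ∀ m, Measurable (Gm d m (H m)) := fun m => Gm_meas d m _ (hH m)
  have hFm : Measurable F := by
    simp only [hF]; exact Finset.measurable_fun_sum _ fun m _ => hGmeas m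
  have hGL : ∀ m ∈ S, MemLp (Gm d m (H m)) (ENNReal.ofReal s) volume := by
    intro m hm
    refine ⟨(hGmeas m).aestronglyMeasurable, ?_⟩
    rw [eLpNorm_lt_top_iff_lintegral_rpow_enorm_lt_top (by simp; linarith) (by simp),
      ENNReal.toReal_ofReal (by linarith)]
    exact lt_of_le_of_lt (Gm_int d m _ (hH m) s hs1.le) (lt_top_iff_ne_top.2 (hXm m hm))
  have hFL : MemLp F (ENNReal.ofReal s) volume := memLp_finsetSum _ hGL
  set I : ℝ≥0∞ := ∫⁻ x, ‖F x‖ₑ ^ s with hI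
  have hIt : I ≠ ⊤ := by
    have := hFL.2
    rw [eLpNorm_lt_top_iff_lintegral_rpow_enorm_lt_top (by simp; linarith) (by simp),
      ENNReal.toReal_ofReal (by linarith)] at this
    exact this.ne
  set h : ℝ × ℝ → ℂ := fun x => conj (F x) * ((‖F x‖ ^ (s - 2) : ℝ) : ℂ) with hh
  have hhm : Measurable h := by
    simp only [hh]
    exact (Complex.continuous_conj.measurable.comp hFm).mul
      (Complex.measurable_ofReal.comp (hFm.norm.pow_const _))
  have hhn : ∀ x, ‖h x‖ₑ = ‖F x‖ₑ ^ (s - 1) := by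
    intro x
    by_cases h0 : F x = 0
    · simp [hh, h0, hs1]
    have hpos : 0 < ‖F x‖ := norm_pos_iff.2 h0
    rw [← ofReal_norm, ← ofReal_norm, ENNReal.ofReal_rpow_of_pos hpos]
    congr 1
    simp only [hh, norm_mul, RCLike.norm_conj, Complex.norm_real, Real.norm_eq_abs]
    rw [abs_of_pos (by positivity)]
    nth_rewrite 1 [← Real.rpow_one ‖F x‖]
    rw [← Real.rpow_add hpos]; congr 1; ring
  have hFh : ∀ x, F x * h x = ((‖F x‖ ^ s : ℝ) : ℂ) := by
    intro x
    by_cases h0 : F x = 0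
    · simp [hh, h0, (by linarith : s ≠ 0)]
    have hpos : 0 < ‖F x‖ := norm_pos_iff.2 h0
    simp only [hh]
    rw [← mul_assoc, Complex.mul_conj, Complex.normSq_eq_norm_sq, ← Complex.ofReal_mul]
    congr 1
    rw [← Real.rpow_natCast, ← Real.rpow_add hpos]; congr 1; push_cast; ring
  have hhI : ∫⁻ x, ‖h x‖ₑ ^ w = I := by
    refine lintegral_congr fun x => ?_
    rw [hhn, ← ENNReal.rpow_mul, hws]
  have hI1 : I = ‖∫ x, F x * h x‖ₑ := by
    simp_rw [hFh]
    rw [show (∫ x, ((‖F x‖ ^ s : ℝ) : ℂ)) = ((∫ x, ‖F x‖ ^ s : ℝ) : ℂ) from integral_ofReal (𝕜 := ℂ), ← ofReal_norm, Complex.norm_real, Real.norm_of_nonneg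
      (integral_nonneg fun _ => by positivity), integral_eq_lintegral_of_nonneg_ae (ae_of_all _ fun _ => by positivity)
      ((hFm.norm.pow_const _).aestronglyMeasurable)]
    have e : ∀ x, ENNReal.ofReal (‖F x‖ ^ s) = ‖F x‖ₑ ^ s := fun x => by
      rw [← ofReal_norm, ENNReal.ofReal_rpow_of_nonneg (norm_nonneg _) (by linarith)]
    simp_rw [e]
    rw [ENNReal.ofReal_toReal hIt]
  have hhL : MemLp h (ENNReal.ofReal w) volume := by
    refine ⟨hhm.aestronglyMeasurable, ?_⟩
    rw [eLpNorm_lt_top_iff_lintegral_rpow_enorm_lt_top (by simp; linarith) (by simp),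
      ENNReal.toReal_ofReal (by linarith), hhI]
    exact lt_top_iff_ne_top.2 hIt
  have hHC : ENNReal.HolderConjugate (ENNReal.ofReal s) (ENNReal.ofReal w) := hsw.ennrealOfReal
  have hI2 : ∫ x, F x * h x = ∑ m ∈ S, ∫ x, H m x * Tm d m h x := by
    have : ∀ x, F x * h x = ∑ m ∈ S, Gm d m (H m) x * h x := fun x => by
      simp only [hF]; rw [Finset.sum_mul]
    simp_rw [this]
    rw [integral_finsetSum]
    · refine Finset.sum_congr rfl fun m hm => ?_
      exact Gm_dual d m _ _ (hH m) hhm s w hsw (hXm m hm) (by rw [hhI]; exact hIt)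
    · intro m hm
      exact (hGL m hm).integrable_mul hhL
  have hmain : I ≤ (∑ m ∈ S, ∫⁻ x, ‖H m x‖ₑ ^ s) ^ (1/s) * (B' * I) ^ (1/w) := by
    conv_lhs => rw [hI1, hI2]
    calc _ ≤ ∑ m ∈ S, ∫⁻ x, ‖H m x‖ₑ * ‖Tm d m h x‖ₑ := by
          refine (enorm_sum_le _ _).trans (Finset.sum_le_sum fun m _ => ?_)
          refine (enorm_integral_le_lintegral_enorm _).trans (le_of_eq (lintegral_congr fun y => ?_))
          rw [enorm_mul]
      _ ≤ ∑ m ∈ S, (∫⁻ x, ‖H m x‖ₑ ^ s) ^ (1/s) * (∫⁻ x, ‖Tm d m h x‖ₑ ^ w) ^ (1/w) := by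
          refine Finset.sum_le_sum fun m _ => ?_
          have h1 := hH m
          have h2 := Tm_meas d m h hhm
          exact ENNReal.lintegral_mul_le_Lp_mul_Lq volume hsw (f := fun x => ‖H m x‖ₑ)
            (g := fun x => ‖Tm d m h x‖ₑ) (by fun_prop) (by fun_prop)
      _ ≤ _ := by
          refine (ENNReal.inner_le_Lp_mul_Lq S _ _ hsw).trans ?_
          have e1 : ∀ (z : ℝ≥0∞), (z ^ (1/s)) ^ s = z := fun z => by
            rw [← ENNReal.rpow_mul, one_div_mul_cancel (by linarith), ENNReal.rpow_one]
          have e2 : ∀ (z : ℝ≥0∞), (z ^ (1/w)) ^ w = z := fun z => by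
            rw [← ENNReal.rpow_mul, one_div_mul_cancel (by linarith), ENNReal.rpow_one]
          simp_rw [e1, e2]
          gcongr
          rw [← hhI]
          exact Tm_int d S h hhm w hw2
  by_cases hI0 : I = 0
  · rw [hI0]; exact zero_le
  -- raise to power `s` and cancel
  set X := ∑ m ∈ S, ∫⁻ x, ‖H m x‖ₑ ^ s with hXdef
  have h5 : I ^ s ≤ B' ^ (s - 1) * X * I ^ (s - 1) := by
    calc I ^ s ≤ (X ^ (1/s) * (B' * I) ^ (1/w)) ^ s := by gcongr
      _ = _ := by
        rw [ENNReal.mul_rpow_of_nonneg _ _ (by linarith), ← ENNReal.rpow_mul, ← ENNReal.rpow_mul,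
          one_div_mul_cancel (by linarith), ENNReal.rpow_one]
        have : 1 / w * s = s - 1 := by
          field_simp [(by linarith : w ≠ 0)]; linarith
        rw [this, ENNReal.mul_rpow_of_nonneg _ _ (by linarith)]; ring
  have h6 : I ^ s = I * I ^ (s - 1) := by
    nth_rewrite 2 [← ENNReal.rpow_one I]
    rw [← ENNReal.rpow_add _ _ hI0 hIt]; congr 1; ring
  rw [h6] at h5
  exact (ENNReal.mul_le_mul_iff_left (by simp [hI0, hIt]) (by simp [hI0, hIt])).1 h5


/-- the oscillating factor -/
noncomputable def ee (p : ℝ × ℝ × ℝ) (ξ : ℝ × ℝ) : ℂ :=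
  Complex.exp (Complex.I * (p.1 * ξ.1 * ξ.2 + p.2.1 * ξ.1 + p.2.2 * ξ.2 : ℝ))

lemma extOp_eq (f : ℝ × ℝ → ℂ) (p : ℝ × ℝ × ℝ) : extOp f p = ∫ ξ, ee p ξ * f ξ := rfl

lemma norm_ee (p : ℝ × ℝ × ℝ) (ξ : ℝ × ℝ) : ‖ee p ξ‖ = 1 := by
  unfold ee
  rw [mul_comm, Complex.norm_exp_ofReal_mul_I]

lemma enorm_ee (p : ℝ × ℝ × ℝ) (ξ : ℝ × ℝ) : ‖ee p ξ‖ₑ = 1 := by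
  rw [← ofReal_norm, norm_ee]; simp

lemma continuous_ee : Continuous (fun q : (ℝ × ℝ × ℝ) × (ℝ × ℝ) => ee q.1 q.2) := by
  unfold ee; fun_prop

lemma continuous_ee_right (p : ℝ × ℝ × ℝ) : Continuous (ee p) := by
  unfold ee; fun_prop

lemma integrable_ee {f : ℝ × ℝ → ℂ} (hf : Integrable f) (p : ℝ × ℝ × ℝ) :
    Integrable (fun ξ => ee p ξ * f ξ) :=
  hf.mono ((continuous_ee_right p).aestronglyMeasurable.mul hf.1)
    (ae_of_all _ fun ξ => by rw [norm_mul, norm_ee, one_mul])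

lemma continuous_extOp {f : ℝ × ℝ → ℂ} (hf : Integrable f) : Continuous (extOp f) := by
  refine continuous_of_dominated (F := fun p ξ => ee p ξ * f ξ) (bound := fun ξ => ‖f ξ‖)
    (fun p => (integrable_ee hf p).1) (fun p => ae_of_all _ fun ξ => ?_) hf.norm
    (ae_of_all _ fun ξ => ?_)
  · rw [norm_mul, norm_ee, one_mul]
  · have : Continuous fun p => ee p ξ := continuous_ee.comp (g := fun q => ee q.1 q.2)
        (f := fun p : ℝ × ℝ × ℝ => (p, ξ)) (by fun_prop)
    exact this.mul continuous_const

lemma enorm_extOp_le (f : ℝ × ℝ → ℂ) (p : ℝ × ℝ × ℝ) : ‖extOp f p‖ₑ ≤ ∫⁻ ξ, ‖f ξ‖ₑ := by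
  rw [extOp_eq]
  refine (enorm_integral_le_lintegral_enorm _).trans (le_of_eq (lintegral_congr fun ξ => ?_))
  rw [enorm_mul, enorm_ee, one_mul]

lemma extOp_congr {f g : ℝ × ℝ → ℂ} (h : f =ᵐ[volume] g) : extOp f = extOp g := by
  ext p
  rw [extOp_eq, extOp_eq]
  refine integral_congr_ae ?_
  filter_upwards [h] with ξ hξ
  rw [hξ]

lemma extOp_mul (f g : ℝ × ℝ → ℂ) (p : ℝ × ℝ × ℝ) :
    extOp f p * extOp g p = ∫ z : (ℝ × ℝ) × (ℝ × ℝ), (ee p z.1 * f z.1) * (ee p z.2 * g z.2) := by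
  rw [extOp_eq, extOp_eq, ← integral_prod_mul]; rfl

/-- half open unit square -/
def Qs (m : ℤ × ℤ) : Set (ℝ × ℝ) := Ico (m.1 : ℝ) (m.1 + 1) ×ˢ Ico (m.2 : ℝ) (m.2 + 1)

lemma measurableSet_Qs (m : ℤ × ℤ) : MeasurableSet (Qs m) := measurableSet_Ico.prod measurableSet_Ico

/-- exponential weight on the unit square -/
noncomputable def ew (m : ℤ × ℤ) (ξ : ℝ × ℝ) : ℝ := Real.exp ((ξ.1 - m.1) + (ξ.2 - m.2))

/-- localized and weighted function -/
noncomputable def loc (m : ℤ × ℤ) (f : ℝ × ℝ → ℂ) : ℝ × ℝ → ℂ := fun ξ =>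
  (ew m ξ : ℂ) * (Qs m).indicator f ξ

lemma norm_loc_le (m : ℤ × ℤ) (f : ℝ × ℝ → ℂ) (ξ : ℝ × ℝ) :
    ‖loc m f ξ‖ ≤ Real.exp 2 * ‖(Qs m).indicator f ξ‖ := by
  unfold loc
  rw [norm_mul]
  by_cases h : ξ ∈ Qs m
  · gcongr
    rw [Complex.norm_real, ew, Real.norm_of_nonneg (Real.exp_nonneg _)]
    obtain ⟨h1, h2⟩ := h
    have := h1.2; have := h2.2
    exact Real.exp_le_exp.2 (by linarith)
  · simp [h]

lemma integrable_loc (m : ℤ × ℤ) {f : ℝ × ℝ → ℂ} (hf : Integrable f) : Integrable (loc m f) := by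
  have h1 := hf.indicator (measurableSet_Qs m)
  refine (h1.norm.const_mul (Real.exp 2)).mono' ?_ (ae_of_all _ (norm_loc_le m f))
  unfold loc ew
  exact AEStronglyMeasurable.mul (Continuous.aestronglyMeasurable (by fun_prop)) h1.1

lemma conv_identity (d m : ℤ × ℤ) {f g : ℝ × ℝ → ℂ} (hf : Integrable f) (hg : Integrable g)
    (t : ℝ) (x : ℝ × ℝ) :
    Gm d m (fun x => extOp (loc m f) (t, x) * extOp (loc (m + d) g) (t, x)) x =
      extOp ((Qs m).indicator f) (t, x) * extOp ((Qs (m + d)).indicator g) (t, x) := by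
  set f' := loc m f
  set g' := loc (m + d) g
  have hf' : Integrable f' := integrable_loc m hf
  have hg' : Integrable g' := integrable_loc (m + d) hg
  have hi : Integrable (fun z : (ℝ × ℝ) × (ℝ × ℝ) => f' z.1 * g' z.2) := hf'.mul_prod hg'
  have hI : Integrable (Function.uncurry fun (y : ℝ × ℝ) (z : (ℝ × ℝ) × (ℝ × ℝ)) =>
      ph d m y * ((ee (t, x - y) z.1 * f' z.1) * (ee (t, x - y) z.2 * g' z.2)))
      (mu2.prod volume) := by
    have h0 : Integrable (fun q : (ℝ × ℝ) × ((ℝ × ℝ) × (ℝ × ℝ)) => f' q.2.1 * g' q.2.2)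
      (mu2.prod volume) := hi.comp_snd mu2
    have h1 : Continuous (fun q : (ℝ × ℝ) × ((ℝ × ℝ) × (ℝ × ℝ)) =>
        ph d m q.1 * ee (t, x - q.1) q.2.1 * ee (t, x - q.1) q.2.2) := by
      have e1 : Continuous fun q : (ℝ × ℝ) × ((ℝ × ℝ) × (ℝ × ℝ)) => ee (t, x - q.1) q.2.1 :=
        continuous_ee.comp (g := fun q => ee q.1 q.2)
          (f := fun q : (ℝ × ℝ) × ((ℝ × ℝ) × (ℝ × ℝ)) => ((t, x - q.1), q.2.1)) (by fun_prop)
      have e2 : Continuous fun q : (ℝ × ℝ) × ((ℝ × ℝ) × (ℝ × ℝ)) => ee (t, x - q.1) q.2.2 :=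
        continuous_ee.comp (g := fun q => ee q.1 q.2)
          (f := fun q : (ℝ × ℝ) × ((ℝ × ℝ) × (ℝ × ℝ)) => ((t, x - q.1), q.2.2)) (by fun_prop)
      exact (((continuous_ph d m).comp continuous_fst).mul e1).mul e2
    refine (h0.mono (h1.aestronglyMeasurable.mul h0.1) (ae_of_all _ fun q => ?_)).congr
      (ae_of_all _ fun q => ?_)
    · simp only [norm_mul, norm_ph, norm_ee, one_mul, Pi.mul_apply]; rfl
    · simp only [Function.uncurry, Pi.mul_apply]; ring
  unfold Gm
  simp_rw [extOp_mul, ← integral_const_mul]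
  rw [integral_integral_swap hI]
  refine integral_congr_ae (ae_of_all _ fun z => ?_)
  simp only []
  by_cases hz : z.1 ∈ Qs m ∧ z.2 ∈ Qs (m + d)
  · obtain ⟨hz1, hz2⟩ := hz
    have hz1' := hz1; have hz2' := hz2
    obtain ⟨⟨a1, -⟩, ⟨a2, -⟩⟩ := hz1
    obtain ⟨⟨b1, -⟩, ⟨b2, -⟩⟩ := hz2
    simp only [Prod.fst_add, Prod.snd_add, Int.cast_add] at b1 b2
    set α : ℝ := z.1.1 + z.2.1 - 2 * m.1 - d.1 with hα
    set β : ℝ := z.1.2 + z.2.2 - 2 * m.2 - d.2 with hβ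
    have key : ∀ y : ℝ × ℝ, ph d m y * ((ee (t, x - y) z.1 * f' z.1) * (ee (t, x - y) z.2 * g' z.2))
        = ((ee (t, x) z.1 * f' z.1) * (ee (t, x) z.2 * g' z.2)) *
          Complex.exp (Complex.I * ((-α) * y.1 + (-β) * y.2 : ℝ)) := by
      intro y
      have : ph d m y * ee (t, x - y) z.1 * ee (t, x - y) z.2 = ee (t, x) z.1 * ee (t, x) z.2 *
          Complex.exp (Complex.I * ((-α) * y.1 + (-β) * y.2 : ℝ)) := by
        unfold ph ee
        simp only [← Complex.exp_add]
        congr 1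
        simp only [hα, hβ, Prod.fst_sub, Prod.snd_sub]
        push_cast; ring
      linear_combination (f' z.1 * g' z.2) * this
    simp_rw [key]
    rw [integral_const_mul, mu2_char]
    simp only [f', g', loc, ew]
    rw [abs_neg, abs_neg, abs_of_nonneg (by linarith), abs_of_nonneg (by linarith)]
    have hexp : (Real.exp (z.1.1 - m.1 + (z.1.2 - m.2)) : ℂ) *
      (Real.exp (z.2.1 - (m + d).1 + (z.2.2 - (m + d).2)) : ℂ) * ((Real.exp (-α) : ℂ) * (Real.exp (-β) : ℂ)) = 1 := by
      norm_cast
      rw [← Real.exp_add, ← Real.exp_add, ← Real.exp_add, ← Real.exp_zero]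
      congr 1
      simp only [hα, hβ, Prod.fst_add, Prod.snd_add, Int.cast_add]
      ring
    linear_combination (ee (t, x) z.1 * ee (t, x) z.2 * (Qs m).indicator f z.1 * (Qs (m + d)).indicator g z.2) * hexp
  · have h0 : f' z.1 * g' z.2 = 0 := by
      rcases not_and_or.1 hz with h | h
      · simp [f', loc, h]
      · simp [g', loc, h]
    have h0' : (Qs m).indicator f z.1 * (Qs (m + d)).indicator g z.2 = 0 := by
      rcases not_and_or.1 hz with h | h
      · simp [h]
      · simp [h]
    have : ∀ y : ℝ × ℝ, ph d m y * ((ee (t, x - y) z.1 * f' z.1) * (ee (t, x - y) z.2 * g' z.2)) = 0 := by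
      intro y
      linear_combination (ph d m y * ee (t, x - y) z.1 * ee (t, x - y) z.2) * h0
    simp_rw [this]
    rw [integral_zero]
    linear_combination (- ee (t, x) z.1 * ee (t, x) z.2) * h0'

lemma support_loc (m : ℤ × ℤ) (f : ℝ × ℝ → ℂ) : Function.support (loc m f) ⊆ unitSq m.1 m.2 := by
  intro ξ hξ
  have : ξ ∈ Qs m := by
    by_contra h
    exact hξ (by simp [loc, h])
  exact ⟨Ico_subset_Icc_self this.1, Ico_subset_Icc_self this.2⟩

lemma eLpNorm_loc_le (m : ℤ × ℤ) (f : ℝ × ℝ → ℂ) (Ω : Set (ℝ × ℝ)) (hΩ : MeasurableSet Ω)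
    (hf : ∀ ξ, ‖f ξ‖ ≤ Ω.indicator (fun _ => (1:ℝ)) ξ) (r : ℝ) (hr : 0 < r) :
    eLpNorm (loc m f) (ENNReal.ofReal r) volume ≤
      ENNReal.ofReal (Real.exp 2) * volume (Ω ∩ Qs m) ^ (1 / r) := by
  have h1 : eLpNorm (loc m f) (ENNReal.ofReal r) volume ≤ ENNReal.ofReal (Real.exp 2) *
      eLpNorm ((Ω ∩ Qs m).indicator (fun _ => (1:ℝ))) (ENNReal.ofReal r) volume := by
    refine eLpNorm_le_mul_eLpNorm_of_ae_le_mul (ae_of_all _ fun ξ => ?_) _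
    refine (norm_loc_le m f ξ).trans ?_
    gcongr
    by_cases h : ξ ∈ Qs m
    · rw [indicator_of_mem h]
      refine (hf ξ).trans ?_
      by_cases h' : ξ ∈ Ω
      · simp [h, h']
      · simp [h, h']
    · simp [h]
  refine h1.trans (le_of_eq ?_)
  rw [eLpNorm_indicator_const (hΩ.inter (measurableSet_Qs m)) (by simpa using hr) (by simp),
    ENNReal.toReal_ofReal hr.le]
  simp

lemma eLpNorm_loc_mono (m : ℤ × ℤ) (f : ℝ × ℝ → ℂ) (hf : Integrable f) {r₀ r : ℝ} (h : r₀ ≤ r) :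
    eLpNorm (loc m f) (ENNReal.ofReal r₀) volume ≤ eLpNorm (loc m f) (ENNReal.ofReal r) volume := by
  have e : ∀ q, eLpNorm (loc m f) q (volume.restrict (Qs m)) = eLpNorm (loc m f) q volume := by
    intro q
    rw [← eLpNorm_indicator_eq_eLpNorm_restrict (measurableSet_Qs m)]
    congr 1
    ext ξ
    by_cases h : ξ ∈ Qs m <;> simp [loc, h]
  rw [← e, ← e]
  have hv : volume (Qs m) = 1 := by
    rw [Qs, Measure.volume_eq_prod, Measure.prod_prod, Real.volume_Ico, Real.volume_Ico]; simp
  haveI : IsProbabilityMeasure (volume.restrict (Qs m)) := ⟨by rw [Measure.restrict_apply_univ, hv]⟩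
  exact eLpNorm_le_eLpNorm_of_exponent_le (ENNReal.ofReal_le_ofReal h)
    (integrable_loc m hf).1.restrict

lemma unit_scale (s r₀ r A : ℝ) (hs1 : 1 < s) (hs2 : s ≤ 2) (hr : 0 < r) (hr0 : r₀ ≤ r)
    (hBH : BH s r₀ A) :
    ∃ C : ℝ≥0∞, C ≠ ⊤ ∧ ∀ (f g : ℝ × ℝ → ℂ) (Ω Ω' : Set (ℝ × ℝ)), Integrable f → Integrable g →
      MeasurableSet Ω → MeasurableSet Ω' →
      (∀ ξ, ‖f ξ‖ ≤ Ω.indicator (fun _ => (1:ℝ)) ξ) →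
      (∀ ξ, ‖g ξ‖ ≤ Ω'.indicator (fun _ => (1:ℝ)) ξ) →
      ∀ (d : ℤ × ℤ), 2 ≤ |d.1| → |d.1| ≤ 5 → 2 ≤ |d.2| → |d.2| ≤ 5 → ∀ S : Finset (ℤ × ℤ),
      ∫⁻ p, ‖∑ m ∈ S, extOp ((Qs m).indicator f) p * extOp ((Qs (m + d)).indicator g) p‖ₑ ^ s ≤
        C * ∑ m ∈ S, (volume (Ω ∩ Qs m) * volume (Ω' ∩ Qs (m + d))) ^ (s / r) := by
  refine ⟨(1 + ENNReal.ofReal Bc) ^ (s - 1) *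
    (ENNReal.ofReal A * ENNReal.ofReal (Real.exp 2) * ENNReal.ofReal (Real.exp 2)) ^ s, ?_, ?_⟩
  · refine ENNReal.mul_ne_top (ENNReal.rpow_ne_top_of_nonneg (by linarith) (by simp))
      (ENNReal.rpow_ne_top_of_nonneg (by linarith) ?_)
    exact ENNReal.mul_ne_top (ENNReal.mul_ne_top (by simp) (by simp)) (by simp)
  intro f g Ω Ω' hf hg hΩ hΩ' hfb hgb d h1 h2 h3 h4 S
  have hcf : ∀ m, Continuous (extOp ((Qs m).indicator f)) := fun m =>
    continuous_extOp (hf.indicator (measurableSet_Qs m))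
  have hcg : ∀ m, Continuous (extOp ((Qs m).indicator g)) := fun m =>
    continuous_extOp (hg.indicator (measurableSet_Qs m))
  have hcf' : ∀ m, Continuous (extOp (loc m f)) := fun m => continuous_extOp (integrable_loc m hf)
  have hcg' : ∀ m, Continuous (extOp (loc m g)) := fun m => continuous_extOp (integrable_loc m hg)
  rw [Measure.volume_eq_prod, lintegral_prod _ (Continuous.aemeasurable (by fun_prop)) |>.trans rfl]
  calc _ ≤ ∫⁻ t, (1 + ENNReal.ofReal Bc) ^ (s - 1) * ∑ m ∈ S, ∫⁻ x,
        ‖extOp (loc m f) (t, x) * extOp (loc (m + d) g) (t, x)‖ₑ ^ s := by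
        refine lintegral_mono fun t => ?_
        have := orth s hs1 hs2 d S (fun m x => extOp (loc m f) (t, x) * extOp (loc (m + d) g) (t, x))
          (fun m => Continuous.measurable (by fun_prop))
        simp_rw [conv_identity d _ hf hg] at this
        exact this
    _ = (1 + ENNReal.ofReal Bc) ^ (s - 1) * ∑ m ∈ S, ∫⁻ p,
        ‖extOp (loc m f) p * extOp (loc (m + d) g) p‖ₑ ^ s := by
        rw [lintegral_const_mul' _ _ (ENNReal.rpow_ne_top_of_nonneg (by linarith) (by simp)),
          lintegral_finsetSum']
        · congr 1
          refine Finset.sum_congr rfl fun m _ => ?_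
          exact (lintegral_prod (μ := volume) (ν := volume) (fun p : ℝ × ℝ × ℝ =>
            ‖extOp (loc m f) p * extOp (loc (m + d) g) p‖ₑ ^ s)
            (Continuous.aemeasurable (by fun_prop))).symm
        · intro m _
          have : Measurable (fun p : ℝ × ℝ × ℝ => ‖extOp (loc m f) p * extOp (loc (m + d) g) p‖ₑ ^ s) :=
            Continuous.measurable (by fun_prop)
          exact this.lintegral_prod_right'.aemeasurable
    _ ≤ (1 + ENNReal.ofReal Bc) ^ (s - 1) * ∑ m ∈ S, 
        ((ENNReal.ofReal A * ENNReal.ofReal (Real.exp 2) * ENNReal.ofReal (Real.exp 2)) ^ s *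
          (volume (Ω ∩ Qs m) * volume (Ω' ∩ Qs (m + d))) ^ (s / r)) := by
        gcongr with m hm
        have hb := hBH m.1 m.2 (m + d).1 (m + d).2
          (by simp; exact_mod_cast h1) (by simp; exact_mod_cast h2)
          (by simp; exact_mod_cast h3) (by simp; exact_mod_cast h4) (loc m f) (loc (m + d) g)
          (support_loc m f) (support_loc (m + d) g)
        rw [eLpNorm_eq_lintegral_rpow_enorm_toReal (by simp; linarith) (by simp),
          ENNReal.toReal_ofReal (by linarith)] at hb
        calc _ = ((∫⁻ p, ‖extOp (loc m f) p * extOp (loc (m + d) g) p‖ₑ ^ s) ^ (1 / s)) ^ s := by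
              rw [← ENNReal.rpow_mul, one_div_mul_cancel (by linarith), ENNReal.rpow_one]
          _ ≤ (ENNReal.ofReal A * (ENNReal.ofReal (Real.exp 2) * volume (Ω ∩ Qs m) ^ (1 / r)) *
              (ENNReal.ofReal (Real.exp 2) * volume (Ω' ∩ Qs (m + d)) ^ (1 / r))) ^ s := by
              refine ENNReal.rpow_le_rpow (hb.trans ?_) (by linarith)
              gcongr
              · exact (eLpNorm_loc_mono m f hf hr0).trans (eLpNorm_loc_le m f Ω hΩ hfb r hr)
              · exact (eLpNorm_loc_mono _ g hg hr0).trans (eLpNorm_loc_le _ g Ω' hΩ' hgb r hr)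
          _ = ((ENNReal.ofReal A * ENNReal.ofReal (Real.exp 2) * ENNReal.ofReal (Real.exp 2)) *
              (volume (Ω ∩ Qs m) * volume (Ω' ∩ Qs (m + d))) ^ (1 / r)) ^ s := by
              rw [ENNReal.mul_rpow_of_nonneg (volume (Ω ∩ Qs m)) _ (by positivity : 0 ≤ 1 / r)]
              congr 1; ring
          _ = _ := by
              rw [ENNReal.mul_rpow_of_nonneg _ _ (by linarith), ← ENNReal.rpow_mul]
              congr 2; ring
    _ = _ := by rw [← Finset.mul_sum, ← mul_assoc]


/-- powers of two -/
noncomputable def pw (x : ℝ) : ℝ≥0∞ := (2 : ℝ≥0∞) ^ x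

lemma pw_add (x y : ℝ) : pw (x + y) = pw x * pw y :=
  ENNReal.rpow_add x y (by simp) (by simp)

lemma pw_rpow (x y : ℝ) : (pw x) ^ y = pw (x * y) := (ENNReal.rpow_mul _ _ _).symm

lemma pw_zero : pw 0 = 1 := by simp [pw]

lemma pw_one : pw 1 = 2 := by simp [pw]

lemma pw_mono {x y : ℝ} (h : x ≤ y) : pw x ≤ pw y :=
  ENNReal.rpow_le_rpow_of_exponent_le (by norm_num) h

lemma pw_ne_top (x : ℝ) : pw x ≠ ⊤ := by
  unfold pw
  simp [ENNReal.rpow_eq_top_iff]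

lemma pw_ne_zero (x : ℝ) : pw x ≠ 0 := by
  unfold pw
  simp [ENNReal.rpow_eq_zero_iff]

lemma pw_pos (x : ℝ) : 0 < pw x := pos_iff_ne_zero.2 (pw_ne_zero x)

lemma pw_mul_neg (x : ℝ) : pw x * pw (-x) = 1 := by rw [← pw_add]; simp [pw_zero]

lemma ofReal_zpow_eq_pw (j : ℤ) : ENNReal.ofReal ((2:ℝ) ^ j) = pw j := by
  unfold pw
  rw [← Real.rpow_intCast, ← ENNReal.ofReal_rpow_of_pos (by norm_num)]
  simp

/-- dilation of the plane -/
def dil (a b : ℝ) : ℝ × ℝ → ℝ × ℝ := Prod.map (fun x => a * x) (fun x => b * x)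

lemma measurable_dil (a b : ℝ) : Measurable (dil a b) := by
  unfold dil; fun_prop

lemma map_dil {a b : ℝ} (ha : 0 < a) (hb : 0 < b) :
    Measure.map (dil a b) (volume : Measure (ℝ × ℝ)) =
      (ENNReal.ofReal a⁻¹ * ENNReal.ofReal b⁻¹) • volume := by
  unfold dil
  rw [Measure.volume_eq_prod, ← Measure.map_prod_map _ _ (by fun_prop) (by fun_prop),
    Real.map_volume_mul_left ha.ne', Real.map_volume_mul_left hb.ne', Measure.prod_smul_left,
    Measure.prod_smul_right, smul_smul, abs_of_pos (by positivity), abs_of_pos (by positivity)]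

lemma map_dil3 {a b : ℝ} (ha : 0 < a) (hb : 0 < b) :
    Measure.map (Prod.map (fun x => (a * b) * x) (dil a b)) (volume : Measure (ℝ × ℝ × ℝ)) =
      (ENNReal.ofReal (a * b)⁻¹ * (ENNReal.ofReal a⁻¹ * ENNReal.ofReal b⁻¹)) • volume := by
  have : (volume : Measure (ℝ × ℝ × ℝ)) = (volume : Measure ℝ).prod (volume : Measure (ℝ × ℝ)) := rfl
  rw [this, ← Measure.map_prod_map _ _ (by fun_prop) (measurable_dil a b), map_dil ha hb,
    Real.map_volume_mul_left (by positivity), Measure.prod_smul_left,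
    Measure.prod_smul_right, smul_smul, abs_of_pos (by positivity)]

/-- dilation as a measurable equivalence -/
noncomputable def dilE (a b : ℝ) (ha : a ≠ 0) (hb : b ≠ 0) : ℝ × ℝ ≃ₜ ℝ × ℝ :=
  (Homeomorph.mulLeft₀ a ha).prodCongr (Homeomorph.mulLeft₀ b hb)

lemma dilE_coe (a b : ℝ) (ha : a ≠ 0) (hb : b ≠ 0) : ⇑(dilE a b ha hb) = dil a b := rfl

lemma measurableEmbedding_dil {a b : ℝ} (ha : 0 < a) (hb : 0 < b) : MeasurableEmbedding (dil a b) := by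
  rw [← dilE_coe a b ha.ne' hb.ne']
  exact (dilE a b ha.ne' hb.ne').measurableEmbedding

lemma extOp_dil {a b : ℝ} (ha : 0 < a) (hb : 0 < b) (f : ℝ × ℝ → ℂ) (p : ℝ × ℝ × ℝ) :
    extOp f p = ((a * b : ℝ) : ℂ) *
      extOp (f ∘ dil a b) (Prod.map (fun x => (a * b) * x) (dil a b) p) := by
  have h := (measurableEmbedding_dil ha hb).integral_map (μ := volume) (fun ξ => ee p ξ * f ξ)
  rw [map_dil ha hb, integral_smul_measure] at h
  have e : ∀ u, ee p (dil a b u) = ee (Prod.map (fun x => (a * b) * x) (dil a b) p) u := by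
    intro u
    unfold ee dil
    congr 3
    simp only [Prod.map]
    ring
  simp_rw [e] at h
  rw [extOp_eq, extOp_eq]
  simp only [Function.comp]
  rw [← h, ← ENNReal.ofReal_mul (by positivity), ENNReal.toReal_ofReal (by positivity)]
  rw [Complex.real_smul, ← mul_assoc, ← Complex.ofReal_mul]
  have : (a * b) * (a⁻¹ * b⁻¹) = 1 := by field_simp
  rw [this]; simp

/-- dyadic interval -/
def dI (j m : ℤ) : Set ℝ := {x | ⌊x / (2:ℝ) ^ j⌋ = m}

lemma dI_eq (j m : ℤ) : dI j m = Ico ((m:ℝ) * 2 ^ j) ((m + 1) * 2 ^ j) := by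
  ext x
  have : (0:ℝ) < 2 ^ j := by positivity
  simp only [dI, mem_ofPred_eq, Int.floor_eq_iff, mem_Ico, le_div_iff₀ this, div_lt_iff₀ this]

lemma measurableSet_dI (j m : ℤ) : MeasurableSet (dI j m) := by rw [dI_eq]; exact measurableSet_Ico

lemma volume_dI (j m : ℤ) : volume (dI j m) = pw j := by
  rw [dI_eq, Real.volume_Ico, ← ofReal_zpow_eq_pw]
  congr 1; ring

/-- dyadic rectangle -/
def tau (j k : ℤ) (m : ℤ × ℤ) : Set (ℝ × ℝ) := dI j m.1 ×ˢ dI k m.2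

lemma measurableSet_tau (j k : ℤ) (m : ℤ × ℤ) : MeasurableSet (tau j k m) :=
  (measurableSet_dI _ _).prod (measurableSet_dI _ _)

lemma dil_preimage_tau (j k : ℤ) (m : ℤ × ℤ) : dil (2 ^ j) (2 ^ k) ⁻¹' tau j k m = Qs m := by
  ext u
  have h1 : (2:ℝ) ^ j ≠ 0 := by positivity
  have h2 : (2:ℝ) ^ k ≠ 0 := by positivity
  simp only [dil, tau, dI, Qs, mem_preimage, mem_prod, Prod.map, mem_ofPred_eq,
    mul_div_cancel_left₀ _ h1, mul_div_cancel_left₀ _ h2, Int.floor_eq_iff, mem_Ico]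

lemma indicator_tau_dil (j k : ℤ) (m : ℤ × ℤ) (f : ℝ × ℝ → ℂ) :
    (tau j k m).indicator f ∘ dil (2 ^ j) (2 ^ k) = (Qs m).indicator (f ∘ dil (2 ^ j) (2 ^ k)) := by
  rw [← dil_preimage_tau j k m]
  ext u; rfl

lemma volume_dil_preimage (j k : ℤ) (X : Set (ℝ × ℝ)) :
    volume (dil (2 ^ j) (2 ^ k) ⁻¹' X) = pw (-((j:ℝ) + k)) * volume X := by
  rw [← (measurableEmbedding_dil (by positivity) (by positivity)).map_apply,
    map_dil (by positivity) (by positivity), Measure.smul_apply, smul_eq_mul, ← zpow_neg, ← zpow_neg,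
    ofReal_zpow_eq_pw, ofReal_zpow_eq_pw, ← pw_add]
  congr 2
  push_cast; ring

lemma scaled (s r₀ r A : ℝ) (hs1 : 1 < s) (hs2 : s ≤ 2) (hr : 0 < r) (hr0 : r₀ ≤ r)
    (hBH : BH s r₀ A) :
    ∃ C : ℝ≥0∞, C ≠ ⊤ ∧ ∀ (f g : ℝ × ℝ → ℂ) (Ω Ω' : Set (ℝ × ℝ)), Integrable f → Integrable g →
      MeasurableSet Ω → MeasurableSet Ω' →
      (∀ ξ, ‖f ξ‖ ≤ Ω.indicator (fun _ => (1:ℝ)) ξ) →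
      (∀ ξ, ‖g ξ‖ ≤ Ω'.indicator (fun _ => (1:ℝ)) ξ) →
      ∀ (j k : ℤ) (d : ℤ × ℤ), 2 ≤ |d.1| → |d.1| ≤ 5 → 2 ≤ |d.2| → |d.2| ≤ 5 →
      ∀ S : Finset (ℤ × ℤ),
      ∫⁻ p, ‖∑ m ∈ S, extOp ((tau j k m).indicator f) p *
          extOp ((tau j k (m + d)).indicator g) p‖ₑ ^ s ≤
        C * (pw (((j:ℝ) + k) * (2 * s - 2 - 2 * (s / r))) *
          ∑ m ∈ S, (volume (Ω ∩ tau j k m) * volume (Ω' ∩ tau j k (m + d))) ^ (s / r)) := by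
  obtain ⟨C, hC, h⟩ := unit_scale s r₀ r A hs1 hs2 hr hr0 hBH
  refine ⟨C, hC, ?_⟩
  intro f g Ω Ω' hf hg hΩ hΩ' hfb hgb j k d h1 h2 h3 h4 S
  have ha : (0:ℝ) < 2 ^ j := by positivity
  have hb : (0:ℝ) < 2 ^ k := by positivity
  set D := dil ((2:ℝ) ^ j) (2 ^ k) with hD
  have hInt : ∀ {f : ℝ × ℝ → ℂ}, Integrable f → Integrable (f ∘ D) := by
    intro f hf
    rw [← (measurableEmbedding_dil ha hb).integrable_map_iff, map_dil ha hb]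
    exact hf.smul_measure (ENNReal.mul_ne_top (by simp) (by simp))
  have key := h (f ∘ D) (g ∘ D) (D ⁻¹' Ω) (D ⁻¹' Ω') (hInt hf) (hInt hg)
    ((measurable_dil _ _) hΩ) ((measurable_dil _ _) hΩ') (fun ξ => hfb (D ξ)) (fun ξ => hgb (D ξ))
    d h1 h2 h3 h4 S
  set G : ℝ × ℝ × ℝ → ℂ := fun p => ∑ m ∈ S, extOp ((Qs m).indicator (f ∘ D)) p *
    extOp ((Qs (m + d)).indicator (g ∘ D)) p with hG
  have hGc : Continuous G := by
    refine continuous_finsetSum _ fun m _ => ?_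
    exact (continuous_extOp ((hInt hf).indicator (measurableSet_Qs _))).mul
      (continuous_extOp ((hInt hg).indicator (measurableSet_Qs _)))
  have hMab : ENNReal.ofReal ((2:ℝ) ^ j * 2 ^ k) = pw ((j:ℝ) + k) := by
    rw [ENNReal.ofReal_mul ha.le, ofReal_zpow_eq_pw, ofReal_zpow_eq_pw, pw_add]
  have hMab' : ENNReal.ofReal ((2:ℝ) ^ j * 2 ^ k)⁻¹ = pw (-((j:ℝ) + k)) := by
    rw [mul_inv, ENNReal.ofReal_mul (by positivity), ← zpow_neg, ← zpow_neg,
      ofReal_zpow_eq_pw, ofReal_zpow_eq_pw, ← pw_add]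
    congr 1
    push_cast; ring
  have e1 : ∀ p, ‖∑ m ∈ S, extOp ((tau j k m).indicator f) p *
          extOp ((tau j k (m + d)).indicator g) p‖ₑ ^ s =
      pw (((j:ℝ) + k) * (2 * s)) * ‖G (Prod.map (fun x => ((2:ℝ) ^ j * 2 ^ k) * x) D p)‖ₑ ^ s := by
    intro p
    have : ∑ m ∈ S, extOp ((tau j k m).indicator f) p *
          extOp ((tau j k (m + d)).indicator g) p = (((2:ℝ) ^ j * 2 ^ k : ℝ) : ℂ) ^ 2 *
          G (Prod.map (fun x => ((2:ℝ) ^ j * 2 ^ k) * x) D p) := by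
      rw [hG]
      simp only []
      rw [Finset.mul_sum]
      refine Finset.sum_congr rfl fun m _ => ?_
      rw [extOp_dil ha hb ((tau j k m).indicator f), extOp_dil ha hb ((tau j k (m+d)).indicator g),
        indicator_tau_dil, indicator_tau_dil]
      ring
    rw [this, enorm_mul, enorm_pow, ENNReal.mul_rpow_of_nonneg _ _ (by linarith)]
    congr 1
    rw [← ofReal_norm, Complex.norm_real, Real.norm_of_nonneg (by positivity), hMab, 
      ← ENNReal.rpow_natCast, pw_rpow, pw_rpow]
    congr 1; push_cast; ring
  simp_rw [e1]
  rw [lintegral_const_mul' _ _ (pw_ne_top _)]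
  have e2 : ∫⁻ p, ‖G (Prod.map (fun x => ((2:ℝ) ^ j * 2 ^ k) * x) D p)‖ₑ ^ s =
      pw (-((j:ℝ) + k) * 2) * ∫⁻ p, ‖G p‖ₑ ^ s := by
    have := lintegral_map (μ := volume) (f := fun p => ‖G p‖ₑ ^ s) 
      (g := Prod.map (fun x => ((2:ℝ) ^ j * 2 ^ k) * x) D) (Continuous.measurable (by fun_prop))
      (Measurable.prodMap (by fun_prop) (measurable_dil _ _))
    rw [← this, map_dil3 ha hb, lintegral_smul_measure, smul_eq_mul, ← ENNReal.ofReal_mul (by positivity),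
      ← mul_inv, hMab', ← pw_add]
    congr 2; ring
  rw [e2]
  refine (mul_le_mul_right (mul_le_mul_right key _) _).trans (le_of_eq ?_)
  have e3 : ∀ m, (volume (D ⁻¹' Ω ∩ Qs m) * volume (D ⁻¹' Ω' ∩ Qs (m + d))) ^ (s / r) =
      pw (((j:ℝ) + k) * (- 2 * (s / r))) * 
        (volume (Ω ∩ tau j k m) * volume (Ω' ∩ tau j k (m + d))) ^ (s / r) := by
    intro m
    rw [← dil_preimage_tau j k m, ← dil_preimage_tau j k (m + d), ← preimage_inter,
      ← preimage_inter, volume_dil_preimage, volume_dil_preimage]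
    have : ∀ a b c : ℝ≥0∞, a * b * (a * c) = (a * a) * (b * c) := by intros; ring
    rw [this, ENNReal.mul_rpow_of_nonneg _ _ (by positivity), ← pw_add, pw_rpow]
    congr 2; ring
  simp_rw [e3]
  rw [← Finset.mul_sum]
  have : ((j:ℝ) + k) * (2 * s - 2 - 2 * (s / r)) = ((j:ℝ) + k) * (2 * s) + (-((j:ℝ) + k) * 2 +
    ((j:ℝ) + k) * (- 2 * (s / r))) := by ring
  rw [this, pw_add, pw_add]
  ring


/-- regular sets -/
def Reg (Ω : Set (ℝ × ℝ)) (A K : ℤ) : Prop :=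
  MeasurableSet Ω ∧ volume Ω ≤ pw ((A:ℝ) + K) ∧
    ∀ I J : Set ℝ, MeasurableSet I → MeasurableSet J →
      volume (Ω ∩ I ×ˢ J) ≤ min (volume I) (pw A) * min (volume J) (pw K)

lemma pw_min (x y : ℝ) : min (pw x) (pw y) = pw (min x y) := by
  rcases le_total x y with h | h
  · rw [min_eq_left h, min_eq_left (pw_mono h)]
  · rw [min_eq_right h, min_eq_right (pw_mono h)]

lemma tau_disjoint (j k : ℤ) {m n : ℤ × ℤ} (h : m ≠ n) : Disjoint (tau j k m) (tau j k n) := by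
  rw [Set.disjoint_left]
  rintro x ⟨h1, h2⟩ ⟨h3, h4⟩
  exact h (Prod.ext (h1.symm.trans h3) (h2.symm.trans h4))

lemma reg_sum {Ω : Set (ℝ × ℝ)} {A K : ℤ} (h : Reg Ω A K) (ρ : ℝ) (hρ : 1 ≤ 2 * ρ) (j k : ℤ)
    (e : ℤ × ℤ) (S : Finset (ℤ × ℤ)) :
    ∑ m ∈ S, (volume (Ω ∩ tau j k (m + e)) ^ ρ) ^ (2:ℝ) ≤
      pw ((min (j:ℝ) A + min (k:ℝ) K) * (2 * ρ - 1) + (A + K)) := by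
  have h1 : ∀ m, volume (Ω ∩ tau j k m) ≤ pw (min (j:ℝ) A + min (k:ℝ) K) := by
    intro m
    refine (h.2.2 _ _ (measurableSet_dI _ _) (measurableSet_dI _ _)).trans (le_of_eq ?_)
    rw [volume_dI, volume_dI, pw_min, pw_min, pw_add]
  have h2 : ∑ m ∈ S, volume (Ω ∩ tau j k (m + e)) ≤ pw ((A:ℝ) + K) := by
    refine le_trans ?_ h.2.1
    rw [← measure_biUnion_finset]
    · exact measure_mono (by simp)
    · intro m _ n _ hmn
      exact (tau_disjoint j k (fun hh => hmn (add_right_cancel hh))).mono inter_subset_right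
        inter_subset_right
    · intro m _
      exact h.1.inter (measurableSet_tau _ _ _)
  calc _ ≤ ∑ m ∈ S, pw (min (j:ℝ) A + min (k:ℝ) K) ^ (2 * ρ - 1) * volume (Ω ∩ tau j k (m + e)) := by
        refine Finset.sum_le_sum fun m _ => ?_
        set v := volume (Ω ∩ tau j k (m + e)) with hv
        have hle := h1 (m + e)
        rw [← hv] at hle
        rw [← ENNReal.rpow_mul]
        have : ρ * 2 = (2 * ρ - 1) + 1 := by ring
        rw [this, ENNReal.rpow_add_of_nonneg _ _ (by linarith) (by norm_num), ENNReal.rpow_one]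
        gcongr
    _ = pw (min (j:ℝ) A + min (k:ℝ) K) ^ (2 * ρ - 1) * ∑ m ∈ S, volume (Ω ∩ tau j k (m + e)) := by
        rw [Finset.mul_sum]
    _ ≤ pw (min (j:ℝ) A + min (k:ℝ) K) ^ (2 * ρ - 1) * pw ((A:ℝ) + K) := by gcongr
    _ = _ := by rw [pw_rpow, ← pw_add]

lemma expo (s ρ γ j A : ℝ) (h1 : γ ≤ 2 * s - 3) (h2 : γ ≤ 2 * ρ - 2 * s + 2) :
    j * (2 * s - 2 - 2 * ρ) + A + (2 * ρ - 1) * min j A ≤ (2 * s - 2) * A - γ * |j - A| := by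
  rcases le_total j A with h | h
  · rw [min_eq_left h, abs_of_nonpos (by linarith)]
    nlinarith
  · rw [min_eq_right h, abs_of_nonneg (by linarith)]
    nlinarith

lemma fixed_scale (s r₀ r A₀ γ : ℝ) (hs1 : 1 < s) (hs2 : s ≤ 2) (hr : 0 < r) (hr0 : r₀ ≤ r)
    (hBH : BH s r₀ A₀) (hρ : 1 ≤ 2 * (s / r)) (hγ1 : γ ≤ 2 * s - 3)
    (hγ2 : γ ≤ 2 * (s / r) - 2 * s + 2) :
    ∃ C : ℝ≥0∞, C ≠ ⊤ ∧ ∀ (f g : ℝ × ℝ → ℂ) (Ω Ω' : Set (ℝ × ℝ)), Integrable f → Integrable g →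
      (∀ ξ, ‖f ξ‖ ≤ Ω.indicator (fun _ => (1:ℝ)) ξ) →
      (∀ ξ, ‖g ξ‖ ≤ Ω'.indicator (fun _ => (1:ℝ)) ξ) → ∀ A K A' K' : ℤ,
      Reg Ω A K → Reg Ω' A' K' →
      ∀ (j k : ℤ) (d : ℤ × ℤ), 2 ≤ |d.1| → |d.1| ≤ 5 → 2 ≤ |d.2| → |d.2| ≤ 5 →
      ∀ S : Finset (ℤ × ℤ),
      ∫⁻ p, ‖∑ m ∈ S, extOp ((tau j k m).indicator f) p *
          extOp ((tau j k (m + d)).indicator g) p‖ₑ ^ s ≤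
        C * pw ((s - 1) * (A + K + A' + K') - γ / 2 *
          (|(j:ℝ) - A| + |(j:ℝ) - A'| + |(k:ℝ) - K| + |(k:ℝ) - K'|)) := by
  obtain ⟨C, hC, h⟩ := scaled s r₀ r A₀ hs1 hs2 hr hr0 hBH
  refine ⟨C, hC, ?_⟩
  intro f g Ω Ω' hf hg hfb hgb A K A' K' hΩ hΩ' j k d h1 h2 h3 h4 S
  refine (h f g Ω Ω' hf hg hΩ.1 hΩ'.1 hfb hgb j k d h1 h2 h3 h4 S).trans ?_
  gcongr
  set ρ := s / r with hρ'
  have hρ0 : 0 ≤ ρ := by positivity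
  have cs := ENNReal.inner_le_Lp_mul_Lq S (fun m => volume (Ω ∩ tau j k m) ^ ρ)
    (fun m => volume (Ω' ∩ tau j k (m + d)) ^ ρ) (p := 2) (q := 2) Real.HolderConjugate.two_two
  have r1 := reg_sum hΩ ρ hρ j k 0 S
  have r2 := reg_sum hΩ' ρ hρ j k d S
  simp only [add_zero] at r1
  calc _ ≤ pw (((j:ℝ) + k) * (2 * s - 2 - 2 * ρ)) *
      (pw ((min (j:ℝ) A + min (k:ℝ) K) * (2 * ρ - 1) + (A + K)) ^ (1 / 2 : ℝ) *
      pw ((min (j:ℝ) A' + min (k:ℝ) K') * (2 * ρ - 1) + (A' + K')) ^ (1 / 2 : ℝ)) := by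
        gcongr
        simp_rw [ENNReal.mul_rpow_of_nonneg _ _ hρ0]
        refine cs.trans ?_
        gcongr
    _ ≤ _ := by
        rw [pw_rpow, pw_rpow, ← pw_add, ← pw_add]
        apply pw_mono
        have e1 := expo s ρ γ j A hγ1 hγ2
        have e2 := expo s ρ γ j A' hγ1 hγ2
        have e3 := expo s ρ γ k K hγ1 hγ2
        have e4 := expo s ρ γ k K' hγ1 hγ2
        linarith



/-- Whitney condition on integers -/
def wc (a b : ℤ) : Prop := 2 ≤ |a - b| ∧ |a / 2 - b / 2| ≤ 1

lemma floor_succ (x : ℝ) (j : ℤ) : ⌊x / (2:ℝ) ^ (j + 1)⌋ = ⌊x / (2:ℝ) ^ j⌋ / 2 := by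
  rw [zpow_add_one₀ (by norm_num), ← div_div]
  exact_mod_cast Int.floor_div_natCast (x / 2 ^ j) 2

lemma wc_bound {a b : ℤ} (h : wc a b) : 2 ≤ |b - a| ∧ |b - a| ≤ 3 := by
  obtain ⟨h1, h2⟩ := h
  rw [abs_sub_comm a b] at h1
  refine ⟨h1, ?_⟩
  rw [abs_le] at h2 ⊢
  omega

/-- number of dyadic intervals between -/
noncomputable def gap (x y : ℝ) (j : ℤ) : ℤ := |⌊x / (2:ℝ) ^ j⌋ - ⌊y / (2:ℝ) ^ j⌋|

lemma gap_succ {x y : ℝ} {j : ℤ} (h : 2 ≤ gap x y (j + 1)) : 2 ≤ gap x y j := by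
  unfold gap at *
  rw [floor_succ, floor_succ] at h
  rw [le_abs] at h ⊢
  omega

lemma gap_down {x y : ℝ} {j i : ℤ} (hij : i ≤ j) (h : 2 ≤ gap x y j) : 2 ≤ gap x y i := by
  induction i, hij using Int.leInductionDown with
  | base => exact h
  | pred n _ ih => exact gap_succ (by simpa using ih)

lemma gap_small {x y : ℝ} (hxy : x ≠ y) : ∃ j, 2 ≤ gap x y j := by
  have h0 : 0 < |x - y| := abs_pos.2 (sub_ne_zero.2 hxy)
  obtain ⟨n, hn⟩ := pow_unbounded_of_one_lt (3 / |x - y|) (by norm_num : (1:ℝ) < 2)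
  refine ⟨-(n:ℤ), ?_⟩
  unfold gap
  have e : ∀ z : ℝ, z / (2:ℝ) ^ (-(n:ℤ)) = z * 2 ^ n := by intro z; rw [zpow_neg]; simp
  rw [e, e]
  rw [div_lt_iff₀ h0] at hn
  have hp : (0:ℝ) < 2 ^ n := by positivity
  have h3 : 3 < |x * 2 ^ n - y * 2 ^ n| := by
    rw [← sub_mul, abs_mul, abs_of_pos hp]; linarith
  have a1 := Int.floor_le (x * 2 ^ n)
  have a2 := Int.lt_floor_add_one (x * 2 ^ n)
  have b1 := Int.floor_le (y * 2 ^ n)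
  have b2 := Int.lt_floor_add_one (y * 2 ^ n)
  have : (2:ℝ) ≤ ((|⌊x * 2 ^ n⌋ - ⌊y * 2 ^ n⌋| : ℤ) : ℝ) := by
    push_cast
    rw [le_abs]
    rcases lt_abs.1 h3 with h | h
    · left; linarith
    · right; linarith
  exact_mod_cast this

lemma gap_large (x y : ℝ) : ∃ j, gap x y j ≤ 1 := by
  obtain ⟨n, hn⟩ := pow_unbounded_of_one_lt (max |x| |y|) (by norm_num : (1:ℝ) < 2)
  refine ⟨n, ?_⟩
  have hp : (0:ℝ) < 2 ^ n := by positivity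
  have h1 : ∀ z : ℝ, |z| < 2 ^ n → ⌊z / (2:ℝ) ^ (n:ℤ)⌋ = 0 ∨ ⌊z / (2:ℝ) ^ (n:ℤ)⌋ = -1 := by
    intro z hz
    rw [zpow_natCast, Int.floor_eq_iff, Int.floor_eq_iff]
    rw [abs_lt] at hz
    simp only [le_div_iff₀ hp, div_lt_iff₀ hp]
    push_cast
    rcases le_total 0 z with h | h
    · left; constructor <;> linarith
    · rcases eq_or_lt_of_le h with h | h
      · left; rw [h]; constructor <;> linarith
      · right; constructor <;> linarith
  have hx := h1 x (lt_of_le_of_lt (le_max_left _ _) hn)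
  have hy := h1 y (lt_of_le_of_lt (le_max_right _ _) hn)
  unfold gap
  rw [abs_le]
  omega

lemma wc_exists {x y : ℝ} (hxy : x ≠ y) : ∃ j : ℤ, wc ⌊x / (2:ℝ) ^ j⌋ ⌊y / (2:ℝ) ^ j⌋ := by
  obtain ⟨j0, h0⟩ := gap_large x y
  obtain ⟨j, hj, hj'⟩ := Int.exists_greatest_of_bdd (P := fun j => 2 ≤ gap x y j)
    ⟨j0, fun z hz => by
      by_contra hlt
      have := gap_down (by omega : j0 ≤ z) hz
      omega⟩ (gap_small hxy)
  refine ⟨j, hj, ?_⟩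
  rw [← floor_succ, ← floor_succ]
  by_contra hlt
  have := hj' (j + 1) (by unfold gap; omega)
  omega

lemma wc_unique {x y : ℝ} {i j : ℤ} (hi : wc ⌊x / (2:ℝ) ^ i⌋ ⌊y / (2:ℝ) ^ i⌋)
    (hj : wc ⌊x / (2:ℝ) ^ j⌋ ⌊y / (2:ℝ) ^ j⌋) : i = j := by
  have key : ∀ {i j : ℤ}, wc ⌊x / (2:ℝ) ^ i⌋ ⌊y / (2:ℝ) ^ i⌋ →
      wc ⌊x / (2:ℝ) ^ j⌋ ⌊y / (2:ℝ) ^ j⌋ → ¬ i < j := by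
    intro i j hi hj hlt
    have h1 : 2 ≤ gap x y j := hj.1
    have h2 := gap_down (by omega : i + 1 ≤ j) h1
    have h3 := hi.2
    rw [← floor_succ, ← floor_succ] at h3
    unfold gap at h2
    omega
  have := key hi hj
  have := key hj hi
  omega


/-- small shifts -/
abbrev Dd : Type := ↥(Finset.Icc (-3:ℤ) 3)

/-- index: scales and shift -/
abbrev Qi : Type := ℤ × ℤ × (Dd × Dd)

/-- the shift vector -/
def shf (q : Qi) : ℤ × ℤ := (q.2.2.1.1, q.2.2.2.1)

/-- good pairs -/
def good (i : Qi × (ℤ × ℤ)) : Prop :=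
  wc i.2.1 (i.2 + shf i.1).1 ∧ wc i.2.2 (i.2 + shf i.1).2

/-- Whitney rectangles -/
def Wh (i : Qi × (ℤ × ℤ)) : Set ((ℝ × ℝ) × (ℝ × ℝ)) :=
  {z | good i ∧ z ∈ tau i.1.1 i.1.2.1 i.2 ×ˢ tau i.1.1 i.1.2.1 (i.2 + shf i.1)}

open Classical in
lemma Wh_eq (i : Qi × (ℤ × ℤ)) : Wh i = if good i then
    tau i.1.1 i.1.2.1 i.2 ×ˢ tau i.1.1 i.1.2.1 (i.2 + shf i.1) else ∅ := by
  unfold Wh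
  split_ifs with h
  · ext z; simp [h]
  · simp [h]

lemma measurableSet_Wh (i : Qi × (ℤ × ℤ)) : MeasurableSet (Wh i) := by
  rw [Wh_eq]
  split_ifs
  · exact (measurableSet_tau _ _ _).prod (measurableSet_tau _ _ _)
  · exact MeasurableSet.empty

lemma Wh_disjoint : Pairwise (Function.onFun Disjoint Wh) := by
  rintro ⟨⟨j, k, d1, d2⟩, m⟩ ⟨⟨j', k', d1', d2'⟩, m'⟩ hne
  rw [Function.onFun, Set.disjoint_left]
  rintro ⟨⟨x1, x2⟩, ⟨y1, y2⟩⟩ ⟨⟨g1, g2⟩, ⟨t1, t2⟩, ⟨t3, t4⟩⟩ ⟨⟨g1', g2'⟩, ⟨t1', t2'⟩, ⟨t3', t4'⟩⟩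
  simp only [dI, mem_ofPred_eq, shf, Prod.fst_add, Prod.snd_add] at *
  rw [← t3, ← t1] at g1
  rw [← t4, ← t2] at g2
  rw [← t3', ← t1'] at g1'
  rw [← t4', ← t2'] at g2'
  have hj := wc_unique g1 g1'
  have hk := wc_unique g2 g2'
  subst hj hk
  apply hne
  have m1 := t1.symm.trans t1'
  have m2 := t2.symm.trans t2'
  have n1 := t3.symm.trans t3'
  have n2 := t4.symm.trans t4'
  have e1 : d1 = d1' := Subtype.ext (by omega)
  have e2 : d2 = d2' := Subtype.ext (by omega)
  have e3 : m = m' := Prod.ext m1 m2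
  rw [e1, e2, e3]

lemma mem_iUnion_Wh {z : (ℝ × ℝ) × (ℝ × ℝ)} (h1 : z.1.1 ≠ z.2.1) (h2 : z.1.2 ≠ z.2.2) :
    z ∈ ⋃ i, Wh i := by
  obtain ⟨⟨x1, x2⟩, ⟨y1, y2⟩⟩ := z
  obtain ⟨j, hj⟩ := wc_exists h1
  obtain ⟨k, hk⟩ := wc_exists h2
  simp only at hj hk
  have b1 := wc_bound hj
  have b2 := wc_bound hk
  rw [mem_iUnion]
  refine ⟨((j, k, ⟨_, Finset.mem_Icc.2 (abs_le.1 b1.2)⟩, ⟨_, Finset.mem_Icc.2 (abs_le.1 b2.2)⟩),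
    (⌊x1 / (2:ℝ) ^ j⌋, ⌊x2 / (2:ℝ) ^ k⌋)), ?_⟩
  simp only [Wh, good, tau, dI, shf, mem_ofPred_eq, mem_prod, Prod.fst_add, Prod.snd_add,
    add_sub_cancel]
  exact ⟨⟨hj, hk⟩, ⟨trivial, trivial⟩, trivial, trivial⟩

lemma ae_mem_Wh : ∀ᵐ z : (ℝ × ℝ) × (ℝ × ℝ), z ∈ ⋃ i, Wh i := by
  have h : ∀ᵐ z : (ℝ × ℝ) × (ℝ × ℝ), z.1.1 ≠ z.2.1 ∧ z.1.2 ≠ z.2.2 := by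
    have hm : MeasurableSet {z : (ℝ × ℝ) × (ℝ × ℝ) | z.1.1 ≠ z.2.1 ∧ z.1.2 ≠ z.2.2} := by
      refine MeasurableSet.inter ?_ ?_
      · exact (measurableSet_eq_fun (by fun_prop) (by fun_prop)).compl
      · exact (measurableSet_eq_fun (by fun_prop) (by fun_prop)).compl
    have := (Measure.ae_prod_iff_ae_ae (μ := (volume : Measure (ℝ × ℝ)))
      (ν := (volume : Measure (ℝ × ℝ))) hm).2 ?_
    · exact this
    refine ae_of_all _ fun x => ?_
    have hm' : MeasurableSet {y : ℝ × ℝ | x.1 ≠ y.1 ∧ x.2 ≠ y.2} := by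
      refine MeasurableSet.inter ?_ ?_
      · exact (measurableSet_eq_fun (by fun_prop) (by fun_prop)).compl
      · exact (measurableSet_eq_fun (by fun_prop) (by fun_prop)).compl
    refine (Measure.ae_prod_iff_ae_ae (μ := (volume : Measure ℝ))
      (ν := (volume : Measure ℝ)) hm').2 ?_
    have n1 : ∀ a : ℝ, ∀ᵐ b : ℝ, a ≠ b := by
      intro a
      filter_upwards [compl_mem_ae_iff.2 (Real.volume_singleton (a := a))] with b hb
      exact fun h => hb h.symm
    filter_upwards [n1 x.1] with y1 h1
    filter_upwards [n1 x.2] with y2 h2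
    exact ⟨h1, h2⟩
  filter_upwards [h] with z hz
  exact mem_iUnion_Wh hz.1 hz.2

open Classical in
lemma hasSum_Wh {f g : ℝ × ℝ → ℂ} (hf : Integrable f) (hg : Integrable g) (p : ℝ × ℝ × ℝ) :
    HasSum (fun i : Qi × (ℤ × ℤ) => if good i then
      extOp ((tau i.1.1 i.1.2.1 i.2).indicator f) p *
        extOp ((tau i.1.1 i.1.2.1 (i.2 + shf i.1)).indicator g) p else 0)
      (extOp f p * extOp g p) := by
  have hi : Integrable (fun z : (ℝ × ℝ) × (ℝ × ℝ) => (ee p z.1 * f z.1) * (ee p z.2 * g z.2)) :=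
    (integrable_ee hf p).mul_prod (integrable_ee hg p)
  have h := hasSum_integral_iUnion measurableSet_Wh Wh_disjoint hi.integrableOn
  have h0 : ∫ z in ⋃ i, Wh i, (ee p z.1 * f z.1) * (ee p z.2 * g z.2) = extOp f p * extOp g p := by
    rw [extOp_mul, Measure.restrict_eq_self_of_ae_mem ae_mem_Wh]
  rw [h0] at h
  have he : ∀ i : Qi × (ℤ × ℤ), (if good i then
      extOp ((tau i.1.1 i.1.2.1 i.2).indicator f) p *
        extOp ((tau i.1.1 i.1.2.1 (i.2 + shf i.1)).indicator g) p else 0) =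
      ∫ z in Wh i, (ee p z.1 * f z.1) * (ee p z.2 * g z.2) := by
    intro i
    rw [← integral_indicator (measurableSet_Wh i), Wh_eq]
    split_ifs with hg
    · rw [extOp_mul]
      congr 1
      ext z
      by_cases h1 : z.1 ∈ tau i.1.1 i.1.2.1 i.2 <;>
        by_cases h2 : z.2 ∈ tau i.1.1 i.1.2.1 (i.2 + shf i.1) <;> simp [indicator, h1, h2]
    · simp
  simp_rw [he]; exact h


/-- two sided geometric sum -/
noncomputable def Zs (c : ℝ) : ℝ≥0∞ := ∑' j : ℤ, pw (-c * |(j:ℝ)|)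

lemma pw_eq_ofReal (x : ℝ) : pw x = ENNReal.ofReal ((2:ℝ) ^ x) := by
  unfold pw
  rw [← ENNReal.ofReal_rpow_of_pos (by norm_num)]
  simp

lemma Zs_ne_top {c : ℝ} (hc : 0 < c) : Zs c ≠ ⊤ := by
  unfold Zs
  simp_rw [pw_eq_ofReal]
  refine Summable.tsum_ofReal_ne_top ?_
  have hg : Summable fun n : ℕ => ((2:ℝ) ^ (-c)) ^ n :=
    summable_geometric_of_lt_one (by positivity)
      (Real.rpow_lt_one_of_one_lt_of_neg (by norm_num) (by linarith))
  have e : ∀ n : ℕ, ((2:ℝ) ^ (-c)) ^ n = (2:ℝ) ^ (-c * (n:ℝ)) := by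
    intro n
    rw [Real.rpow_mul (by norm_num), Real.rpow_natCast]
  simp_rw [e] at hg
  refine Summable.of_nat_of_neg ?_ ?_
  · simpa using hg
  · simpa using hg

lemma Zs_shift (c : ℝ) (A : ℤ) : ∑' j : ℤ, pw (-c * |(j:ℝ) - A|) = Zs c := by
  unfold Zs
  rw [← (Equiv.subRight A).tsum_eq (fun j : ℤ => pw (-c * |(j:ℝ)|))]
  refine tsum_congr fun j => ?_
  simp

open Classical in
lemma sum_split (T : Finset (Qi × (ℤ × ℤ))) (F : Qi × (ℤ × ℤ) → ℂ) :
    ∑ i ∈ T, (if good i then F i else 0) = ∑ q ∈ T.image Prod.fst,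
      ∑ m ∈ (T.image Prod.snd).filter (fun m => (q, m) ∈ T ∧ good (q, m)), F (q, m) := by
  have h1 : ∑ i ∈ T, (if good i then F i else 0) = ∑ i ∈ T, if (i ∈ T ∧ good i) then F i else 0 := by
    refine Finset.sum_congr rfl fun i hi => ?_
    simp [hi]
  have h2 : ∑ i ∈ T, (if (i ∈ T ∧ good i) then F i else 0) =
      ∑ i ∈ T.image Prod.fst ×ˢ T.image Prod.snd, if (i ∈ T ∧ good i) then F i else 0 := by
    refine Finset.sum_subset ?_ ?_
    · intro i hi
      exact Finset.mem_product.2 ⟨Finset.mem_image_of_mem _ hi, Finset.mem_image_of_mem _ hi⟩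
    · intro i _ hi
      simp [hi]
  rw [h1, h2, Finset.sum_product]
  refine Finset.sum_congr rfl fun q _ => ?_
  rw [Finset.sum_filter]
  refine Finset.sum_congr rfl fun m _ => ?_
  congr

lemma pair_bound (s r₀ r A₀ γ : ℝ) (hs1 : 1 < s) (hs2 : s ≤ 2) (hr : 0 < r) (hr0 : r₀ ≤ r)
    (hBH : BH s r₀ A₀) (hρ : 1 ≤ 2 * (s / r)) (hγ0 : 0 < γ) (hγ1 : γ ≤ 2 * s - 3)
    (hγ2 : γ ≤ 2 * (s / r) - 2 * s + 2) :
    ∃ C : ℝ≥0∞, C ≠ ⊤ ∧ ∀ (f g : ℝ × ℝ → ℂ) (Ω Ω' : Set (ℝ × ℝ)), Integrable f → Integrable g →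
      (∀ ξ, ‖f ξ‖ ≤ Ω.indicator (fun _ => (1:ℝ)) ξ) →
      (∀ ξ, ‖g ξ‖ ≤ Ω'.indicator (fun _ => (1:ℝ)) ξ) → ∀ A K A' K' : ℤ,
      Reg Ω A K → Reg Ω' A' K' →
      ∫⁻ p, ‖extOp f p * extOp g p‖ₑ ^ s ≤
        C * pw ((s - 1) * (A + K + A' + K') - γ / 4 * |(K:ℝ) - K'|) := by
  classical
  obtain ⟨C, hC, h⟩ := fixed_scale s r₀ r A₀ γ hs1 hs2 hr hr0 hBH hρ hγ1 hγ2
  have hs0 : 0 < s := by linarith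
  have hc0 : 0 < γ / (4 * s) := by positivity
  set c := γ / (4 * s) with hc
  refine ⟨(C ^ (1 / s) * (Zs c * (Zs c * (Fintype.card (Dd × Dd) : ℝ≥0∞)))) ^ s, ?_, ?_⟩
  · refine ENNReal.rpow_ne_top_of_nonneg hs0.le (ENNReal.mul_ne_top
      (ENNReal.rpow_ne_top_of_nonneg (by positivity) hC) ?_)
    exact ENNReal.mul_ne_top (Zs_ne_top hc0) (ENNReal.mul_ne_top (Zs_ne_top hc0) (by simp))
  intro f g Ω Ω' hf hg hfb hgb A K A' K' hΩ hΩ'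
  set X : ℝ≥0∞ := pw (((s - 1) * (A + K + A' + K') - γ / 4 * |(K:ℝ) - K'|) / s) with hX
  have hcf : ∀ j k m, Continuous (extOp ((tau j k m).indicator f)) := fun j k m =>
    continuous_extOp (hf.indicator (measurableSet_tau j k m))
  have hcg : ∀ j k m, Continuous (extOp ((tau j k m).indicator g)) := fun j k m =>
    continuous_extOp (hg.indicator (measurableSet_tau j k m))
  set F : Qi × (ℤ × ℤ) → (ℝ × ℝ × ℝ) → ℂ := fun i p =>
    extOp ((tau i.1.1 i.1.2.1 i.2).indicator f) p *
        extOp ((tau i.1.1 i.1.2.1 (i.2 + shf i.1)).indicator g) p with hF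
  have hFc : ∀ i, Continuous (F i) := fun i => (hcf _ _ _).mul (hcg _ _ _)
  have hfin : ∀ T : Finset (Qi × (ℤ × ℤ)),
      ∫⁻ p, ‖∑ i ∈ T, (if good i then F i p else 0)‖ₑ ^ s ≤
      (C ^ (1 / s) * (Zs c * (Zs c * (Fintype.card (Dd × Dd) : ℝ≥0∞))) * X) ^ s := by
    intro T
    have hps : ENNReal.ofReal s ≠ 0 := by simpa using hs0
    have e1 : ∀ u : (ℝ × ℝ × ℝ) → ℂ, eLpNorm u (ENNReal.ofReal s) volume =
        (∫⁻ p, ‖u p‖ₑ ^ s) ^ (1 / s) := by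
      intro u
      rw [eLpNorm_eq_lintegral_rpow_enorm_toReal hps (by simp), ENNReal.toReal_ofReal hs0.le]
    have e2 : ∀ x : ℝ≥0∞, x = (x ^ (1 / s)) ^ s := by
      intro x
      rw [← ENNReal.rpow_mul, one_div_mul_cancel hs0.ne', ENNReal.rpow_one]
    rw [e2 (∫⁻ p, _)]
    refine ENNReal.rpow_le_rpow ?_ hs0.le
    rw [← e1 (fun p => ∑ i ∈ T, (if good i then F i p else 0))]
    have e3 : (fun p => ∑ i ∈ T, (if good i then F i p else 0)) = ∑ q ∈ T.image Prod.fst, fun p =>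
        ∑ m ∈ (T.image Prod.snd).filter (fun m => (q, m) ∈ T ∧ good (q, m)), F (q, m) p := by
      ext p
      rw [sum_split T (fun i => F i p), Finset.sum_apply]
    rw [e3]
    refine (eLpNorm_sum_le (fun q _ => Continuous.aestronglyMeasurable
      (continuous_finsetSum _ fun m _ => hFc _)) (by simpa using hs1.le)).trans ?_
    have hq : ∀ q : Qi, eLpNorm (fun p => ∑ m ∈ (T.image Prod.snd).filter
        (fun m => (q, m) ∈ T ∧ good (q, m)), F (q, m) p) (ENNReal.ofReal s) volume ≤
        C ^ (1 / s) * X * (pw (-c * |(q.1:ℝ) - A|) * pw (-c * |(q.2.1:ℝ) - K|)) := by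
      intro q
      rcases Finset.eq_empty_or_nonempty ((T.image Prod.snd).filter
        (fun m => (q, m) ∈ T ∧ good (q, m))) with he | ⟨m0, hm0⟩
      · rw [he]; simp
      have hgood : good (q, m0) := (Finset.mem_filter.1 hm0).2.2
      have b1 := wc_bound hgood.1
      have b2 := wc_bound hgood.2
      simp only [Prod.fst_add, Prod.snd_add, add_sub_cancel_left] at b1 b2
      have := h f g Ω Ω' hf hg hfb hgb A K A' K' hΩ hΩ' q.1 q.2.1 (shf q) b1.1 (by linarith [b1.2])
        b2.1 (by linarith [b2.2]) ((T.image Prod.snd).filter (fun m => (q, m) ∈ T ∧ good (q, m)))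
      rw [e1]
      refine (ENNReal.rpow_le_rpow this (by positivity)).trans ?_
      rw [ENNReal.mul_rpow_of_nonneg _ _ (by positivity), pw_rpow, mul_assoc]
      gcongr
      rw [hX, ← pw_add, ← pw_add]
      apply pw_mono
      have t1 : |(K:ℝ) - K'| ≤ |(q.2.1:ℝ) - K| + |(q.2.1:ℝ) - K'| := by
        rw [abs_sub_comm (q.2.1:ℝ) K]
        exact abs_sub_le _ _ _
      have t2 := abs_nonneg ((q.1:ℝ) - A')
      have t3 := abs_nonneg ((q.1:ℝ) - A)
      have t4 := abs_nonneg ((q.2.1:ℝ) - K)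
      have t5 := abs_nonneg ((q.2.1:ℝ) - K')
      have hcs : c = γ / 4 / s := by rw [hc]; field_simp
      rw [hcs]
      have : ((s - 1) * (A + K + A' + K') - γ / 4 * |(K:ℝ) - K'|) / s + (-(γ / 4 / s) * |(q.1:ℝ) - A| +
          -(γ / 4 / s) * |(q.2.1:ℝ) - K|) = ((s - 1) * (A + K + A' + K') - γ / 4 * (|(K:ℝ) - K'| +
          |(q.1:ℝ) - A| + |(q.2.1:ℝ) - K|)) * (1 / s) := by field_simp; ring
      rw [this]
      apply mul_le_mul_of_nonneg_right _ (by positivity)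
      nlinarith
    calc _ ≤ ∑ q ∈ T.image Prod.fst,
          C ^ (1 / s) * X * (pw (-c * |(q.1:ℝ) - A|) * pw (-c * |(q.2.1:ℝ) - K|)) :=
          Finset.sum_le_sum fun q _ => hq q
      _ ≤ ∑' q : Qi, C ^ (1 / s) * X * (pw (-c * |(q.1:ℝ) - A|) * pw (-c * |(q.2.1:ℝ) - K|)) :=
          ENNReal.sum_le_tsum _
      _ = C ^ (1 / s) * X * (Zs c * (Zs c * (Fintype.card (Dd × Dd) : ℝ≥0∞))) := by
          rw [ENNReal.tsum_mul_left, ENNReal.tsum_prod (f := fun (j : ℤ) (b : ℤ × (Dd × Dd)) =>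
            pw (-c * |(j:ℝ) - A|) * pw (-c * |(b.1:ℝ) - K|))]
          congr 1
          simp_rw [ENNReal.tsum_mul_left]
          rw [ENNReal.tsum_mul_right, Zs_shift, ENNReal.tsum_prod (f := fun (k : ℤ) (_ : Dd × Dd) =>
            pw (-c * |(k:ℝ) - K|))]
          simp only [tsum_fintype, Finset.sum_const, nsmul_eq_mul]
          rw [ENNReal.tsum_mul_left, Zs_shift, Finset.card_univ, mul_comm (Zs c) (Fintype.card _ : ℝ≥0∞)]
      _ = _ := by ring
  have hlim : ∀ p, ‖extOp f p * extOp g p‖ₑ ^ s = Filter.liminf (fun T : Finset (Qi × (ℤ × ℤ)) =>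
      ‖∑ i ∈ T, (if good i then F i p else 0)‖ₑ ^ s) Filter.atTop := by
    intro p
    have h1 : Filter.Tendsto (fun T : Finset (Qi × (ℤ × ℤ)) => ∑ i ∈ T, (if good i then F i p else 0))
      Filter.atTop (nhds (extOp f p * extOp g p)) := hasSum_Wh hf hg p
    exact ((h1.enorm).ennrpow_const s).liminf_eq.symm
  simp_rw [hlim]
  refine (lintegral_liminf_le fun T => ?_).trans ?_
  · refine Continuous.measurable (ENNReal.continuous_rpow_const.comp (continuous_enorm.comp
      (continuous_finsetSum _ fun i _ => ?_)))
    split_ifs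
    · exact hFc i
    · exact continuous_const
  · refine (Filter.liminf_le_liminf (Filter.Eventually.of_forall hfin)).trans ?_
    rw [Filter.liminf_const, ENNReal.mul_rpow_of_nonneg _ _ hs0.le, hX, pw_rpow,
      div_mul_cancel₀ _ hs0.ne']


lemma rpow_tsum_le {ι : Type*} (h : ι → ℝ≥0∞) (t : ℝ) (ht0 : 0 < t) (ht1 : t ≤ 1) :
    (∑' i, h i) ^ t ≤ ∑' i, h i ^ t := by
  have hfin : ∀ T : Finset ι, (∑ i ∈ T, h i) ^ t ≤ ∑ i ∈ T, h i ^ t := by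
    classical
    intro T
    induction T using Finset.induction_on with
    | empty => simp [ht0]
    | insert a T ha ih =>
      rw [Finset.sum_insert ha, Finset.sum_insert ha]
      exact (ENNReal.rpow_add_le_add_rpow _ _ ht0.le ht1).trans (by gcongr)
  have h1 : Filter.Tendsto (fun T : Finset ι => (∑ i ∈ T, h i) ^ t) Filter.atTop
      (nhds ((∑' i, h i) ^ t)) := (ENNReal.summable.hasSum (f := h)).ennrpow_const t
  exact le_of_tendsto h1 (Filter.Eventually.of_forall fun T => (hfin T).trans (ENNReal.sum_le_tsum T))

lemma tsum_rpow_le {ι : Type*} (v : ι → ℝ≥0∞) (t : ℝ) (ht : 1 ≤ t) :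
    ∑' i, v i ^ t ≤ (∑' i, v i) ^ t := by
  have e : ∀ x : ℝ≥0∞, x ^ t = x * x ^ (t - 1) := by
    intro x
    conv_lhs => rw [show t = 1 + (t - 1) by ring, ENNReal.rpow_add_of_nonneg _ _ (by norm_num) (by linarith),
      ENNReal.rpow_one]
  rw [e (∑' i, v i), ← ENNReal.tsum_mul_right]
  refine ENNReal.tsum_le_tsum fun i => ?_
  rw [e]
  gcongr
  exact ENNReal.le_tsum i

lemma four_le (a b c d : ℝ≥0∞) : a * b * (c * d) ≤ a ^ 4 + b ^ 4 + (c ^ 4 + d ^ 4) := by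
  set M := max (max a b) (max c d) with hM
  have ha : a ≤ M := (le_max_left _ _).trans (le_max_left _ _)
  have hb : b ≤ M := (le_max_right _ _).trans (le_max_left _ _)
  have hc : c ≤ M := (le_max_left _ _).trans (le_max_right _ _)
  have hd : d ≤ M := (le_max_right _ _).trans (le_max_right _ _)
  calc _ ≤ M * M * (M * M) := by gcongr
    _ = M ^ 4 := by ring
    _ ≤ _ := by
      rcases max_choice (max a b) (max c d) with h | h <;> rw [← hM] at h
      · rcases max_choice a b with h' | h' <;> rw [h, h']
        · exact le_trans le_self_add le_self_add
        · exact le_trans le_add_self le_self_add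
      · rcases max_choice c d with h' | h' <;> rw [h, h']
        · exact le_trans le_self_add le_add_self
        · exact le_trans le_add_self le_add_self

lemma tsum_four (x : ℤ → ℝ≥0∞) (c : ℝ) :
    ∑' a : ℤ, ∑' b : ℤ, ∑' d : ℤ, ∑' e : ℤ, x a * x b * (x d * x e) *
      (pw (-c * |(a:ℝ) - b|) * pw (-c * |(a:ℝ) - d|) * pw (-c * |(d:ℝ) - e|)) ≤
      4 * Zs c ^ 3 * ∑' a, x a ^ 4 := by
  have sh : ∀ (G : ℤ → ℝ≥0∞) (a : ℤ), ∑' b, G b = ∑' m, G (a + m) := fun G a =>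
    ((Equiv.addLeft a).tsum_eq G).symm
  have sh' : ∀ (G : ℤ → ℝ≥0∞) (a : ℤ), ∑' m, G (m + a) = ∑' b, G b := fun G a =>
    ((Equiv.addRight a).tsum_eq G)
  have e1 : ∀ a : ℤ, ∑' b : ℤ, ∑' d : ℤ, ∑' e : ℤ, x a * x b * (x d * x e) *
      (pw (-c * |(a:ℝ) - b|) * pw (-c * |(a:ℝ) - d|) * pw (-c * |(d:ℝ) - e|)) =
      ∑' q : ℤ × ℤ × ℤ, x a * x (a + q.1) * (x (a + q.2.1) * x (a + q.2.1 + q.2.2)) *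
      (pw (-c * |(q.1:ℝ)|) * (pw (-c * |(q.2.1:ℝ)|) * pw (-c * |(q.2.2:ℝ)|))) := by
    intro a
    rw [ENNReal.tsum_prod (f := fun (m : ℤ) (q : ℤ × ℤ) => x a * x (a + m) * (x (a + q.1) * x (a + q.1 + q.2)) *
      (pw (-c * |(m:ℝ)|) * (pw (-c * |(q.1:ℝ)|) * pw (-c * |(q.2:ℝ)|)))), sh _ a]
    refine tsum_congr fun m => ?_
    rw [ENNReal.tsum_prod (f := fun (n : ℤ) (l : ℤ) => x a * x (a + m) * (x (a + n) * x (a + n + l)) *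
      (pw (-c * |(m:ℝ)|) * (pw (-c * |(n:ℝ)|) * pw (-c * |(l:ℝ)|)))), sh _ a]
    refine tsum_congr fun n => ?_
    rw [sh _ (a + n)]
    refine tsum_congr fun l => ?_
    have t1 : |(a:ℝ) - (a + m : ℤ)| = |(m:ℝ)| := by rw [← abs_neg]; congr 1; push_cast; ring
    have t2 : |(a:ℝ) - (a + n : ℤ)| = |(n:ℝ)| := by rw [← abs_neg]; congr 1; push_cast; ring
    have t3 : |((a + n : ℤ):ℝ) - (a + n + l : ℤ)| = |(l:ℝ)| := by rw [← abs_neg]; congr 1; push_cast; ring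
    rw [t1, t2, t3, mul_assoc (pw _)]
  simp_rw [e1]
  rw [ENNReal.tsum_comm]
  calc _ ≤ ∑' q : ℤ × ℤ × ℤ, 4 * (∑' a, x a ^ 4) *
      (pw (-c * |(q.1:ℝ)|) * (pw (-c * |(q.2.1:ℝ)|) * pw (-c * |(q.2.2:ℝ)|))) := by
        refine ENNReal.tsum_le_tsum fun q => ?_
        rw [ENNReal.tsum_mul_right]
        gcongr
        calc _ ≤ ∑' a, (x a ^ 4 + x (a + q.1) ^ 4 + (x (a + q.2.1) ^ 4 + x (a + q.2.1 + q.2.2) ^ 4)) :=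
              ENNReal.tsum_le_tsum fun a => four_le _ _ _ _
          _ = _ := by
            simp_rw [add_assoc _ q.2.1 q.2.2]
            rw [ENNReal.tsum_add, ENNReal.tsum_add, ENNReal.tsum_add, sh' (fun a => x a ^ 4),
              sh' (fun a => x a ^ 4), sh' (fun a => x a ^ 4)]
            ring
    _ = _ := by
        rw [ENNReal.tsum_mul_left, ENNReal.tsum_prod (f := fun (m : ℤ) (q : ℤ × ℤ) => 
          (pw (-c * |(m:ℝ)|) * (pw (-c * |(q.1:ℝ)|) * pw (-c * |(q.2:ℝ)|))))]
        simp_rw [ENNReal.tsum_mul_left]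
        rw [ENNReal.tsum_mul_right, ENNReal.tsum_prod (f := fun (m : ℤ) (q : ℤ) => 
          (pw (-c * |(m:ℝ)|) * pw (-c * |(q:ℝ)|)))]
        simp_rw [ENNReal.tsum_mul_left]
        rw [ENNReal.tsum_mul_right]
        unfold Zs
        ring

lemma quad {α : Type*} [MeasurableSpace α] (μ : Measure α) (h : ℤ → α → ℝ≥0∞)
    (hm : ∀ a, Measurable (h a)) (v : ℤ → ℝ≥0∞) (s c : ℝ) (C : ℝ≥0∞) (hs1 : 3 / 2 ≤ s) (hs2 : s ≤ 2)
    (hc : 0 ≤ c)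
    (hB : ∀ a b : ℤ, ∫⁻ p, (h a p * h b p) ^ s ∂μ ≤
      C * ((v a * v b) ^ (s - 1) * pw (-c * |(a:ℝ) - b|))) :
    ∫⁻ p, (∑' a, h a p) ^ (2 * s) ∂μ ≤ C * (4 * Zs (c / 4) ^ 3) * (∑' a, v a) ^ (2 * (s - 1)) := by
  have hs0 : 0 < s := by linarith
  set u : ℤ → α → ℝ≥0∞ := fun a p => h a p ^ (s / 2) with hu
  have hum : ∀ a, Measurable (u a) := fun a => (hm a).pow_const _
  set x : ℤ → ℝ≥0∞ := fun a => v a ^ ((s - 1) / 2) with hx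
  -- Cauchy-Schwarz
  have cs : ∀ a b d e : ℤ, ∫⁻ p, u a p * u b p * (u d p * u e p) ∂μ ≤
      C * (x a * x b * (x d * x e)) * (pw (-(c / 2) * |(a:ℝ) - b|) * pw (-(c / 2) * |(d:ℝ) - e|)) := by
    intro a b d e
    have h1 := ENNReal.lintegral_mul_le_Lp_mul_Lq μ Real.HolderConjugate.two_two
      (f := fun p => u a p * u b p) (g := fun p => u d p * u e p)
      ((hum a).mul (hum b)).aemeasurable ((hum d).mul (hum e)).aemeasurable
    have h2 : ∀ a b : ℤ, (∫⁻ p, (u a p * u b p) ^ (2:ℝ) ∂μ) ^ (1 / 2 : ℝ) ≤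
        C ^ (1 / 2 : ℝ) * (x a * x b) * pw (-(c / 2) * |(a:ℝ) - b|) := by
      intro a b
      have e0 : ∀ p, (u a p * u b p) ^ (2:ℝ) = (h a p * h b p) ^ s := by
        intro p
        rw [hu]
        simp only []
        rw [← ENNReal.mul_rpow_of_nonneg _ _ (by positivity), ← ENNReal.rpow_mul]
        congr 1; ring
      simp_rw [e0]
      refine (ENNReal.rpow_le_rpow (hB a b) (by norm_num)).trans (le_of_eq ?_)
      rw [ENNReal.mul_rpow_of_nonneg _ _ (by norm_num), ENNReal.mul_rpow_of_nonneg _ _ (by norm_num),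
        ← ENNReal.rpow_mul, pw_rpow, ENNReal.mul_rpow_of_nonneg _ _ (by linarith), hx]
      simp only []
      have e4 : (s - 1) * (1 / 2) = (s - 1) / 2 := by ring
      have e5 : -c * |(a:ℝ) - b| * (1 / 2) = -(c / 2) * |(a:ℝ) - b| := by ring
      rw [e4, e5]
      ring
    refine h1.trans ((mul_le_mul' (h2 a b) (h2 d e)).trans (le_of_eq ?_))
    have hCC : C = C ^ (1 / 2 : ℝ) * C ^ (1 / 2 : ℝ) := by
      rw [← ENNReal.rpow_add_of_nonneg _ _ (by norm_num) (by norm_num)]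
      norm_num
    conv_rhs => rw [hCC]
    ring
  have cs2 : ∀ a b d e : ℤ, ∫⁻ p, u a p * u b p * (u d p * u e p) ∂μ ≤
      C * (x a * x b * (x d * x e) *
        (pw (-(c / 4) * |(a:ℝ) - b|) * pw (-(c / 4) * |(a:ℝ) - d|) * pw (-(c / 4) * |(d:ℝ) - e|))) := by
    intro a b d e
    set J := ∫⁻ p, u a p * u b p * (u d p * u e p) ∂μ with hJ
    have j1 := cs a b d e
    have j2 := cs a d b e
    have hJ2 : ∫⁻ p, u a p * u d p * (u b p * u e p) ∂μ = J := by
      rw [hJ]; refine lintegral_congr fun p => ?_; ring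
    rw [hJ2] at j2
    rw [← hJ] at j1
    obtain ⟨Y, hY⟩ : ∃ Y, Y = C * (x a * x b * (x d * x e)) := ⟨_, rfl⟩
    rw [← hY] at j1
    have hY2 : C * (x a * x d * (x b * x e)) = Y := by rw [hY]; ring
    rw [hY2] at j2
    have half : ∀ z : ℝ≥0∞, z = z ^ (1 / 2 : ℝ) * z ^ (1 / 2 : ℝ) := by
      intro z
      rw [← ENNReal.rpow_add_of_nonneg _ _ (by norm_num) (by norm_num)]
      norm_num
    rw [half J]
    refine (mul_le_mul' (ENNReal.rpow_le_rpow j1 (by norm_num))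
      (ENNReal.rpow_le_rpow j2 (by norm_num))).trans ?_
    rw [← pw_add, ← pw_add, ENNReal.mul_rpow_of_nonneg _ _ (by norm_num),
      ENNReal.mul_rpow_of_nonneg _ _ (by norm_num), pw_rpow, pw_rpow, mul_mul_mul_comm, ← half,
      ← pw_add, ← pw_add, ← pw_add, ← mul_assoc C, ← hY]
    gcongr
    apply pw_mono
    have t2 := abs_nonneg ((b:ℝ) - e)
    nlinarith
  have p1 : ∀ p, (∑' a, h a p) ^ (2 * s) ≤
      ∑' a : ℤ, ∑' b : ℤ, ∑' d : ℤ, ∑' e : ℤ, u a p * u b p * (u d p * u e p) := by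
    intro p
    have : (∑' a, h a p) ^ (2 * s) = ((∑' a, h a p) ^ (s / 2)) ^ 4 := by
      rw [← ENNReal.rpow_natCast, ← ENNReal.rpow_mul]
      congr 1; push_cast; ring
    rw [this]
    refine (pow_le_pow_left' (rpow_tsum_le (fun a => h a p) (s / 2) (by linarith) (by linarith)) 4).trans
      (le_of_eq ?_)
    simp only [ENNReal.tsum_mul_left, ENNReal.tsum_mul_right]
    show (∑' a, u a p) ^ 4 = _
    ring
  calc _ ≤ ∫⁻ p, ∑' a : ℤ, ∑' b : ℤ, ∑' d : ℤ, ∑' e : ℤ, u a p * u b p * (u d p * u e p) ∂μ :=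
        lintegral_mono p1
    _ = ∑' a : ℤ, ∑' b : ℤ, ∑' d : ℤ, ∑' e : ℤ, ∫⁻ p, u a p * u b p * (u d p * u e p) ∂μ := by
        have m4 : ∀ a b d e, Measurable fun p => u a p * u b p * (u d p * u e p) := by
          intro a b d e; fun_prop
        have m3 : ∀ a b d, Measurable fun p => ∑' e : ℤ, u a p * u b p * (u d p * u e p) :=
          fun a b d => Measurable.tsum (m4 a b d)
        have m2 : ∀ a b, Measurable fun p => ∑' d : ℤ, ∑' e : ℤ, u a p * u b p * (u d p * u e p) :=
          fun a b => Measurable.tsum (m3 a b)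
        have m1 : ∀ a, Measurable fun p => ∑' b : ℤ, ∑' d : ℤ, ∑' e : ℤ, u a p * u b p * (u d p * u e p) :=
          fun a => Measurable.tsum (m2 a)
        rw [lintegral_tsum fun a => (m1 a).aemeasurable]
        refine tsum_congr fun a => ?_
        rw [lintegral_tsum fun b => (m2 a b).aemeasurable]
        refine tsum_congr fun b => ?_
        rw [lintegral_tsum fun d => (m3 a b d).aemeasurable]
        refine tsum_congr fun d => ?_
        rw [lintegral_tsum fun e => (m4 a b d e).aemeasurable]
    _ ≤ ∑' a : ℤ, ∑' b : ℤ, ∑' d : ℤ, ∑' e : ℤ, C * (x a * x b * (x d * x e) *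
        (pw (-(c / 4) * |(a:ℝ) - b|) * pw (-(c / 4) * |(a:ℝ) - d|) * pw (-(c / 4) * |(d:ℝ) - e|))) :=
        ENNReal.tsum_le_tsum fun a => ENNReal.tsum_le_tsum fun b => ENNReal.tsum_le_tsum fun d =>
          ENNReal.tsum_le_tsum fun e => cs2 a b d e
    _ = C * ∑' a : ℤ, ∑' b : ℤ, ∑' d : ℤ, ∑' e : ℤ, (x a * x b * (x d * x e) *
        (pw (-(c / 4) * |(a:ℝ) - b|) * pw (-(c / 4) * |(a:ℝ) - d|) * pw (-(c / 4) * |(d:ℝ) - e|))) := by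
        simp_rw [ENNReal.tsum_mul_left (a := C)]
    _ ≤ C * (4 * Zs (c / 4) ^ 3 * ∑' a, x a ^ 4) := by
        gcongr
        exact tsum_four x (c / 4)
    _ ≤ C * (4 * Zs (c / 4) ^ 3 * (∑' a, v a) ^ (2 * (s - 1))) := by
        gcongr
        refine le_trans (le_of_eq ?_) (tsum_rpow_le v (2 * (s - 1)) (by linarith))
        refine tsum_congr fun a => ?_
        rw [hx]
        simp only []
        rw [← ENNReal.rpow_natCast, ← ENNReal.rpow_mul]
        congr 1; push_cast; ring
    _ = _ := by ring


lemma exists_pw {x : ℝ≥0∞} (h0 : x ≠ 0) (h1 : x ≠ ⊤) : ∃ n : ℤ, pw n ≤ x ∧ x < pw ((n:ℝ) + 1) := by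
  obtain ⟨n, hn⟩ := ENNReal.exists_mem_Ico_zpow h0 h1 (y := 2) (by norm_num) (by norm_num)
  refine ⟨n, ?_, ?_⟩
  · have := hn.1
    rwa [← ENNReal.rpow_intCast] at this
  · have := hn.2
    rw [← ENNReal.rpow_intCast] at this
    unfold pw
    push_cast at this
    exact this

lemma pw_window {x : ℝ≥0∞} {m n : ℤ} (h1 : pw m ≤ x) (h2 : x < pw ((m:ℝ) + 1))
    (h3 : pw n ≤ x) (h4 : x < pw ((n:ℝ) + 1)) : m = n := by
  have key : ∀ {m n : ℤ}, pw m < pw ((n:ℝ) + 1) → m ≤ n := by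
    intro m n h
    by_contra hlt
    have : (n:ℝ) + 1 ≤ m := by exact_mod_cast (by omega : n + 1 ≤ m)
    exact absurd (pw_mono this) (not_le.2 h)
  exact le_antisymm (key (h1.trans_lt h4)) (key (h3.trans_lt h2))

/-- fiber length -/
noncomputable def fib (Ω : Set (ℝ × ℝ)) (x : ℝ) : ℝ≥0∞ := volume (Prod.mk x ⁻¹' Ω)

lemma measurable_fib {Ω : Set (ℝ × ℝ)} (hΩ : MeasurableSet Ω) : Measurable (fib Ω) :=
  measurable_measure_prodMk_left hΩ

/-- base set -/
def bas (Ω : Set (ℝ × ℝ)) (K : ℤ) : Set ℝ := {x | pw K ≤ fib Ω x ∧ fib Ω x < pw ((K:ℝ) + 1)}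

/-- pieces with fibers of comparable length -/
def pc (Ω : Set (ℝ × ℝ)) (K : ℤ) : Set (ℝ × ℝ) := {ξ | ξ ∈ Ω ∧ ξ.1 ∈ bas Ω K}

lemma measurableSet_bas {Ω : Set (ℝ × ℝ)} (hΩ : MeasurableSet Ω) (K : ℤ) :
    MeasurableSet (bas Ω K) :=
  (measurableSet_le measurable_const (measurable_fib hΩ)).inter
    (measurableSet_lt (measurable_fib hΩ) measurable_const)

lemma measurableSet_pc {Ω : Set (ℝ × ℝ)} (hΩ : MeasurableSet Ω) (K : ℤ) :
    MeasurableSet (pc Ω K) :=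
  hΩ.inter (measurable_fst (measurableSet_bas hΩ K))

lemma pc_disjoint (Ω : Set (ℝ × ℝ)) : Pairwise (Function.onFun Disjoint (pc Ω)) := by
  intro K K' hne
  rw [Function.onFun, Set.disjoint_left]
  rintro ξ ⟨_, h1, h2⟩ ⟨_, h3, h4⟩
  exact hne (pw_window h1 h2 h3 h4)

lemma vol_eq (X : Set (ℝ × ℝ)) (hX : MeasurableSet X) : volume X = ∫⁻ x, volume (Prod.mk x ⁻¹' X) :=
  Measure.prod_apply hX

lemma vol_pc_inter {Ω : Set (ℝ × ℝ)} (hΩ : MeasurableSet Ω) (K : ℤ) {I J : Set ℝ}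
    (hI : MeasurableSet I) (hJ : MeasurableSet J) :
    volume (pc Ω K ∩ I ×ˢ J) ≤ min (volume J) (pw ((K:ℝ) + 1)) * volume (I ∩ bas Ω K) := by
  rw [vol_eq _ ((measurableSet_pc hΩ K).inter (hI.prod hJ)),
    ← lintegral_indicator_const (hI.inter (measurableSet_bas hΩ K))]
  refine lintegral_mono fun x => ?_
  by_cases hx : x ∈ I ∩ bas Ω K
  · simp only [indicator_of_mem hx]
    refine le_min ?_ ?_
    · exact measure_mono fun y hy => hy.2.2
    · refine le_trans (measure_mono ?_) hx.2.2.le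
      exact fun y hy => hy.1.1
  · have : Prod.mk x ⁻¹' (pc Ω K ∩ I ×ˢ J) = ∅ := by
      ext y
      simp only [mem_preimage, mem_empty_iff_false, iff_false]
      rintro ⟨⟨_, h1⟩, h2, _⟩
      exact hx ⟨h2, h1⟩
    rw [this]; simp

lemma bas_le {Ω : Set (ℝ × ℝ)} (hΩ : MeasurableSet Ω) (K : ℤ) :
    pw K * volume (bas Ω K) ≤ volume (pc Ω K) := by
  rw [vol_eq _ (measurableSet_pc hΩ K), ← lintegral_indicator_const (measurableSet_bas hΩ K)]
  refine lintegral_mono fun x => ?_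
  by_cases hx : x ∈ bas Ω K
  · simp only [indicator_of_mem hx]
    refine hx.1.trans (measure_mono fun y hy => ⟨hy, hx⟩)
  · simp [hx]

lemma reg_pc {Ω : Set (ℝ × ℝ)} (hΩ : MeasurableSet Ω) (hfin : volume Ω ≠ ⊤) (K : ℤ)
    (h0 : volume (pc Ω K) ≠ 0) :
    ∃ A : ℤ, Reg (pc Ω K) A (K + 1) ∧ pw ((A:ℝ) + (K + 1 : ℤ)) ≤ 4 * volume (pc Ω K) := by
  have hft : volume (pc Ω K) ≠ ⊤ := ne_top_of_le_ne_top hfin (measure_mono fun ξ h => h.1)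
  obtain ⟨n, hn1, hn2⟩ := exists_pw (x := pw (-K) * volume (pc Ω K))
    (mul_ne_zero (pw_ne_zero _) h0) (ENNReal.mul_ne_top (pw_ne_top _) hft)
  have back : volume (pc Ω K) = pw K * (pw (-K) * volume (pc Ω K)) := by
    rw [← mul_assoc, pw_mul_neg, one_mul]
  refine ⟨n + 1, ⟨measurableSet_pc hΩ K, ?_, ?_⟩, ?_⟩
  · rw [back]
    calc _ ≤ pw K * pw ((n:ℝ) + 1) := by gcongr
      _ = pw (K + ((n:ℝ) + 1)) := (pw_add _ _).symm
      _ ≤ _ := pw_mono (by push_cast; linarith)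
  · intro I J hI hJ
    refine (vol_pc_inter hΩ K hI hJ).trans ?_
    rw [mul_comm]
    push_cast
    gcongr
    refine le_min (measure_mono inter_subset_left) ((measure_mono inter_subset_right).trans ?_)
    have := bas_le hΩ K
    calc volume (bas Ω K) = pw (-K) * (pw K * volume (bas Ω K)) := by
          rw [← mul_assoc, mul_comm (pw _) (pw _), pw_mul_neg, one_mul]
      _ ≤ pw (-K) * volume (pc Ω K) := by gcongr
      _ ≤ _ := hn2.le
  · conv_rhs => rw [back]
    calc pw (((n + 1 : ℤ):ℝ) + ((K + 1 : ℤ) : ℝ)) = pw 2 * pw K * pw n := by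
          rw [← pw_add, ← pw_add]; congr 1; push_cast; ring
      _ ≤ pw 2 * pw K * (pw (-K) * volume (pc Ω K)) := by gcongr
      _ = _ := by
        have : pw 2 = 4 := by
          unfold pw
          rw [show (2:ℝ) = ((2:ℕ):ℝ) by norm_num, ENNReal.rpow_natCast]; norm_num
        rw [this]; ring

lemma ae_pc {Ω : Set (ℝ × ℝ)} (hΩ : MeasurableSet Ω) (hfin : volume Ω ≠ ⊤) :
    ∀ᵐ ξ : ℝ × ℝ, ξ ∈ Ω → ξ ∈ ⋃ K, pc Ω K := by
  set N : Set (ℝ × ℝ) := {ξ | ξ ∈ Ω ∧ (fib Ω ξ.1 = 0 ∨ fib Ω ξ.1 = ⊤)} with hN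
  have hNm : MeasurableSet N := by
    have hS : MeasurableSet {x | fib Ω x = 0 ∨ fib Ω x = ⊤} :=
      ((measurable_fib hΩ) (measurableSet_singleton 0)).union
        ((measurable_fib hΩ) (measurableSet_singleton ⊤))
    exact hΩ.inter (measurable_fst hS)
  have hN0 : volume N = 0 := by
    refine (Measure.measure_prod_null (μ := volume) (ν := volume) hNm).2 ?_
    have h1 : ∫⁻ x, fib Ω x ≠ ⊤ := by
      unfold fib
      rwa [← vol_eq Ω hΩ]
    filter_upwards [ae_lt_top (measurable_fib hΩ) h1] with x hx
    by_cases h0 : fib Ω x = 0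
    · exact measure_mono_null (fun y hy => hy.1) h0
    · have : Prod.mk x ⁻¹' N = ∅ := by
        ext y
        simp only [mem_preimage, mem_empty_iff_false, iff_false]
        rintro ⟨_, h | h⟩
        · exact h0 h
        · exact hx.ne h
      rw [this]; simp
  filter_upwards [compl_mem_ae_iff.2 hN0] with ξ hξ hmem
  have hne : ¬ (fib Ω ξ.1 = 0 ∨ fib Ω ξ.1 = ⊤) := fun h => hξ ⟨hmem, h⟩
  push Not at hne
  obtain ⟨K, h1, h2⟩ := exists_pw hne.1 hne.2
  exact mem_iUnion.2 ⟨K, hmem, h1, h2⟩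

/-- countable decompositions -/
lemma enorm_extOp_le_tsum {f : ℝ × ℝ → ℂ} (hf : Integrable f) (P : ℤ → Set (ℝ × ℝ))
    (hm : ∀ K, MeasurableSet (P K)) (hd : Pairwise (Function.onFun Disjoint P))
    (hae : ∀ᵐ ξ : ℝ × ℝ, f ξ ≠ 0 → ξ ∈ ⋃ K, P K) (p : ℝ × ℝ × ℝ) :
    ‖extOp f p‖ₑ ≤ ∑' K, ‖extOp ((P K).indicator f) p‖ₑ := by
  have h := hasSum_integral_iUnion hm hd (integrable_ee hf p).integrableOn
  have h0 : ∫ ξ in ⋃ K, P K, ee p ξ * f ξ = extOp f p := by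
    rw [extOp_eq, ← integral_indicator (MeasurableSet.iUnion hm)]
    refine integral_congr_ae ?_
    filter_upwards [hae] with ξ hξ
    by_cases hz : f ξ = 0
    · simp [indicator, hz]
    · rw [indicator_of_mem (hξ hz)]
  have h1 : ∀ K, ∫ ξ in P K, ee p ξ * f ξ = extOp ((P K).indicator f) p := by
    intro K
    rw [extOp_eq, ← integral_indicator (hm K)]
    congr 1
    ext ξ
    by_cases hz : ξ ∈ P K <;> simp [hz]
  rw [h0] at h
  simp_rw [h1] at h
  refine le_of_tendsto (Filter.Tendsto.enorm h) (Filter.Eventually.of_forall fun T => ?_)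
  exact (enorm_sum_le _ _).trans (ENNReal.sum_le_tsum T)

lemma stepD (s r₀ r A₀ γ : ℝ) (hs1 : 3 / 2 < s) (hs2 : s ≤ 2) (hr : 0 < r) (hr0 : r₀ ≤ r)
    (hBH : BH s r₀ A₀) (hρ : 1 ≤ 2 * (s / r)) (hγ0 : 0 < γ) (hγ1 : γ ≤ 2 * s - 3)
    (hγ2 : γ ≤ 2 * (s / r) - 2 * s + 2) :
    ∃ C : ℝ≥0∞, C ≠ ⊤ ∧ ∀ (f : ℝ × ℝ → ℂ) (Ω : Set (ℝ × ℝ)), Integrable f →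
      MeasurableSet Ω → volume Ω ≠ ⊤ → (∀ ξ, ‖f ξ‖ ≤ Ω.indicator (fun _ => (1:ℝ)) ξ) →
      ∫⁻ p, ‖extOp f p‖ₑ ^ (2 * s) ≤ C * volume Ω ^ (2 * (s - 1)) := by
  obtain ⟨C, hC, h⟩ := pair_bound s r₀ r A₀ γ (by linarith) hs2 hr hr0 hBH hρ hγ0 hγ1 hγ2
  refine ⟨C * 16 ^ (s - 1) * (4 * Zs (γ / 4 / 4) ^ 3), ?_, ?_⟩
  · refine ENNReal.mul_ne_top (ENNReal.mul_ne_top hC (ENNReal.rpow_ne_top_of_nonneg (by linarith)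
      (by norm_num))) (ENNReal.mul_ne_top (by norm_num) (ENNReal.pow_ne_top (Zs_ne_top (by positivity))))
  intro f Ω hf hΩ hfin hfb
  have hInt : ∀ K, Integrable ((pc Ω K).indicator f) := fun K => hf.indicator (measurableSet_pc hΩ K)
  have hbd : ∀ K ξ, ‖(pc Ω K).indicator f ξ‖ ≤ (pc Ω K).indicator (fun _ => (1:ℝ)) ξ := by
    intro K ξ
    by_cases hz : ξ ∈ pc Ω K
    · simp only [indicator_of_mem hz]
      refine (hfb ξ).trans ?_
      rw [indicator_of_mem hz.1]
    · simp [hz]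
  have hzero : ∀ K, volume (pc Ω K) = 0 → ∀ p, extOp ((pc Ω K).indicator f) p = 0 := by
    intro K hK p
    have : (pc Ω K).indicator f =ᵐ[volume] 0 := by
      filter_upwards [compl_mem_ae_iff.2 hK] with ξ hξ
      exact indicator_of_notMem hξ f
    rw [extOp_congr this]
    simp [extOp]
  have hB : ∀ a b : ℤ, ∫⁻ p, (‖extOp ((pc Ω a).indicator f) p‖ₑ * ‖extOp ((pc Ω b).indicator f) p‖ₑ) ^ s ≤
      C * 16 ^ (s - 1) * ((volume (pc Ω a) * volume (pc Ω b)) ^ (s - 1) * pw (-(γ / 4) * |(a:ℝ) - b|)) := by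
    intro a b
    by_cases ha : volume (pc Ω a) = 0
    · simp_rw [hzero a ha]
      simp [show 0 < s by linarith]
    by_cases hb : volume (pc Ω b) = 0
    · simp_rw [hzero b hb]
      simp [show 0 < s by linarith]
    obtain ⟨A, hA, hA'⟩ := reg_pc hΩ hfin a ha
    obtain ⟨B, hB, hB'⟩ := reg_pc hΩ hfin b hb
    have := h _ _ _ _ (hInt a) (hInt b) (hbd a) (hbd b) _ _ _ _ hA hB
    simp_rw [enorm_mul] at this
    refine this.trans ?_
    rw [mul_assoc]
    gcongr
    have e1 : (s - 1) * ((A:ℝ) + (a + 1 : ℤ) + B + (b + 1 : ℤ)) - γ / 4 * |((a + 1 : ℤ):ℝ) - (b + 1 : ℤ)| =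
        ((A:ℝ) + (a + 1 : ℤ) + (B + (b + 1 : ℤ))) * (s - 1) + -(γ / 4) * |(a:ℝ) - b| := by
      push_cast
      rw [show (a:ℝ) + 1 - (b + 1) = a - b by ring]; ring
    rw [e1, pw_add, ← mul_assoc, ← pw_rpow, ← ENNReal.mul_rpow_of_nonneg _ _ (by linarith)]
    refine mul_le_mul' (ENNReal.rpow_le_rpow ?_ (by linarith)) le_rfl
    rw [pw_add]
    calc _ ≤ (4 * volume (pc Ω a)) * (4 * volume (pc Ω b)) := mul_le_mul' hA' hB'
      _ = _ := by ring
  have hq := quad volume (fun K p => ‖extOp ((pc Ω K).indicator f) p‖ₑ)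
    (fun K => (continuous_enorm.comp (continuous_extOp (hInt K))).measurable) (fun K => volume (pc Ω K))
    s (γ / 4) (C * 16 ^ (s - 1)) hs1.le hs2 (by positivity) hB
  calc _ ≤ ∫⁻ p, (∑' K, ‖extOp ((pc Ω K).indicator f) p‖ₑ) ^ (2 * s) := by
        refine lintegral_mono fun p => ENNReal.rpow_le_rpow ?_ (by linarith)
        refine enorm_extOp_le_tsum hf _ (measurableSet_pc hΩ) (pc_disjoint Ω) ?_ p
        filter_upwards [ae_pc hΩ hfin] with ξ hξ hne
        refine hξ ?_
        by_contra hnot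
        have := hfb ξ
        rw [indicator_of_notMem hnot] at this
        exact hne (norm_le_zero_iff.1 this)
    _ ≤ _ := hq
    _ ≤ _ := by
        gcongr
        · linarith
        rw [← measure_iUnion (pc_disjoint Ω) (measurableSet_pc hΩ)]
        exact measure_mono (iUnion_subset fun K ξ h => h.1)


lemma ptw (δ Q q : ℝ) (hδ : 0 < δ) (hQ : 0 < Q) (hq : Q < q) :
    ∃ C : ℝ≥0∞, C ≠ ⊤ ∧ ∀ b : ℤ → ℝ≥0∞, (∀ m : ℤ, b m ≤ 2 * pw (-m * δ)) →
      (∑' m, b m) ^ q ≤ C * ∑' m : ℤ, b m ^ Q * pw (-m * (δ * (q - Q))) := by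
  have hq0 : 0 < q := hQ.trans hq
  set κ := δ * (q - Q) with hκ
  have hκ0 : 0 < κ := mul_pos hδ (by linarith)
  set c := min δ (κ / Q) with hc
  have hc0 : 0 < c := lt_min hδ (by positivity)
  set D : ℝ≥0∞ := 2 * pw (δ * q / Q) with hD
  have hDZ : D * Zs c ≠ ⊤ := ENNReal.mul_ne_top (ENNReal.mul_ne_top (by norm_num) (pw_ne_top _)) (Zs_ne_top hc0)
  have h1D : 1 ≤ pw (δ * q / Q) := by
    rw [← pw_zero]; exact pw_mono (by positivity)
  have hCt : (D * Zs c) ^ q + 1 ≠ ⊤ :=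
    ENNReal.add_ne_top.2 ⟨ENNReal.rpow_ne_top_of_nonneg hq0.le hDZ, by norm_num⟩
  refine ⟨(D * Zs c) ^ q + 1, hCt, ?_⟩
  intro b hb
  set M := ∑' m : ℤ, b m ^ Q * pw (-m * κ) with hM
  have hle : ∀ m : ℤ, b m ^ Q * pw (-m * κ) ≤ M := fun m => ENNReal.le_tsum m
  by_cases hM0 : M = 0
  · have : ∀ m, b m = 0 := by
      intro m
      have h := hle m
      rw [hM0] at h
      rcases mul_eq_zero.1 (le_antisymm h (by simp)) with h | h
      · exact (ENNReal.rpow_eq_zero_iff_of_pos hQ).1 h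
      · exact absurd h (pw_ne_zero _)
    simp [this, hq0]
  by_cases hMt : M = ⊤
  · rw [hMt, ENNReal.mul_top (by simp)]; exact le_top
  obtain ⟨n, hn1, hn2⟩ := exists_pw (x := M ^ (1 / (δ * q)))
    (by simp [hM0, hMt]) (ENNReal.rpow_ne_top_of_nonneg (by positivity) hMt)
  have hMM : M = (M ^ (1 / (δ * q))) ^ (δ * q) := by
    rw [← ENNReal.rpow_mul, one_div_mul_cancel (by positivity), ENNReal.rpow_one]
  have hm1 : pw (n * (δ * q)) ≤ M := by
    rw [hMM, ← pw_rpow]; exact ENNReal.rpow_le_rpow hn1 (by positivity)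
  have hm2 : M ≤ pw ((n + 1) * (δ * q)) := by
    rw [hMM, ← pw_rpow]; exact ENNReal.rpow_le_rpow hn2.le (by positivity)
  have key : ∀ m : ℤ, b m ≤ D * pw (n * δ) * pw (-c * |(m:ℝ) + n|) := by
    intro m
    rcases le_total 0 ((m:ℝ) + n) with h | h
    · refine (hb m).trans ?_
      calc 2 * pw (-m * δ) = 2 * 1 * (pw (n * δ) * pw (-δ * (m + n))) := by
            rw [← pw_add, mul_one]; congr 2; ring
        _ ≤ D * (pw (n * δ) * pw (-c * |(m:ℝ) + n|)) := by
            rw [abs_of_nonneg h]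
            refine mul_le_mul' (mul_le_mul' le_rfl h1D) (mul_le_mul' le_rfl (pw_mono ?_))
            have : c ≤ δ := min_le_left _ _
            nlinarith
        _ = _ := by ring
    · have h1 : b m ^ Q ≤ M * pw (m * κ) := by
        calc b m ^ Q = b m ^ Q * pw (-m * κ) * pw (m * κ) := by
              rw [mul_assoc, ← pw_add, neg_mul, neg_add_cancel, pw_zero, mul_one]
          _ ≤ _ := mul_le_mul' (hle m) le_rfl
      have h2 : b m ≤ (M * pw (m * κ)) ^ (1 / Q) := by
        calc b m = (b m ^ Q) ^ (1 / Q) := by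
              rw [← ENNReal.rpow_mul, mul_one_div_cancel hQ.ne', ENNReal.rpow_one]
          _ ≤ _ := ENNReal.rpow_le_rpow h1 (by positivity)
      refine h2.trans ?_
      calc (M * pw (m * κ)) ^ (1 / Q) ≤ (pw ((n + 1) * (δ * q)) * pw (m * κ)) ^ (1 / Q) :=
            ENNReal.rpow_le_rpow (mul_le_mul' hm2 le_rfl) (by positivity)
        _ = 1 * pw (δ * q / Q) * (pw (n * δ) * pw (κ / Q * (m + n))) := by
            rw [one_mul, ← pw_add, pw_rpow, ← pw_add, ← pw_add]
            congr 1
            rw [hκ]; field_simp; ring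
        _ ≤ D * (pw (n * δ) * pw (-c * |(m:ℝ) + n|)) := by
            rw [abs_of_nonpos h]
            refine mul_le_mul' (mul_le_mul' (by norm_num) le_rfl) (mul_le_mul' le_rfl (pw_mono ?_))
            have : c ≤ κ / Q := min_le_right _ _
            nlinarith
        _ = _ := by ring
  have hsum : ∑' m, b m ≤ D * pw (n * δ) * Zs c := by
    refine (ENNReal.tsum_le_tsum key).trans ?_
    rw [ENNReal.tsum_mul_left]
    refine mul_le_mul' le_rfl (le_of_eq ?_)
    unfold Zs
    rw [← (Equiv.addRight n).tsum_eq (fun j : ℤ => pw (-c * |(j:ℝ)|))]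
    simp
  calc (∑' m, b m) ^ q ≤ (D * pw (n * δ) * Zs c) ^ q := ENNReal.rpow_le_rpow hsum hq0.le
    _ = (D * Zs c) ^ q * pw (n * (δ * q)) := by
        rw [mul_right_comm, ENNReal.mul_rpow_of_nonneg _ _ hq0.le, pw_rpow, mul_assoc (n:ℝ)]
    _ ≤ _ := mul_le_mul' le_self_add hm1


lemma extOp_const_smul (c : ℂ) (f : ℝ × ℝ → ℂ) (p : ℝ × ℝ × ℝ) :
    extOp (c • f) p = c * extOp f p := by
  rw [extOp_eq, extOp_eq, ← integral_const_mul]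
  congr 1
  ext ξ
  simp only [Pi.smul_apply, smul_eq_mul]; ring

/-- dyadic level sets -/
def lev (f : ℝ × ℝ → ℂ) (n : ℤ) : Set (ℝ × ℝ) := {ξ | pw n ≤ ‖f ξ‖ₑ ∧ ‖f ξ‖ₑ < pw ((n:ℝ) + 1)}

lemma measurableSet_lev {f : ℝ × ℝ → ℂ} (hf : StronglyMeasurable f) (n : ℤ) :
    MeasurableSet (lev f n) := by
  have h := hf.enorm
  exact (measurableSet_le measurable_const h).inter (measurableSet_lt h measurable_const)

lemma lev_disjoint (f : ℝ × ℝ → ℂ) : Pairwise (Function.onFun Disjoint (lev f)) := by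
  intro m n hmn
  refine Set.disjoint_left.2 fun ξ h1 h2 => hmn (pw_window h1.1 h1.2 h2.1 h2.2)

lemma level_sum {f : ℝ × ℝ → ℂ} (hf : StronglyMeasurable f) (P : ℝ) (hP : 0 < P) :
    ∑' n : ℤ, pw (n * P) * volume (lev f n) ≤ ∫⁻ ξ, ‖f ξ‖ₑ ^ P := by
  calc ∑' n : ℤ, pw (n * P) * volume (lev f n) ≤ ∑' n : ℤ, ∫⁻ ξ in lev f n, ‖f ξ‖ₑ ^ P := by
        refine ENNReal.tsum_le_tsum fun n => ?_
        rw [← setLIntegral_const]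
        refine setLIntegral_mono' (measurableSet_lev hf n) fun ξ hξ => ?_
        rw [← pw_rpow]
        exact ENNReal.rpow_le_rpow hξ.1 hP.le
    _ = ∫⁻ ξ in ⋃ n, lev f n, ‖f ξ‖ₑ ^ P :=
        (lintegral_iUnion (measurableSet_lev hf) (lev_disjoint f) _).symm
    _ ≤ _ := setLIntegral_le_lintegral _ _

lemma stepE0 (s st : ℝ) (hs1 : 3 / 2 < s) (hst : s < st) (C₀ : ℝ≥0∞) (hC₀ : C₀ ≠ ⊤)
    (hD : ∀ (f : ℝ × ℝ → ℂ) (Ω : Set (ℝ × ℝ)), Integrable f →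
      MeasurableSet Ω → volume Ω ≠ ⊤ → (∀ ξ, ‖f ξ‖ ≤ Ω.indicator (fun _ => (1:ℝ)) ξ) →
      ∫⁻ p, ‖extOp f p‖ₑ ^ (2 * s) ≤ C₀ * volume Ω ^ (2 * (s - 1))) :
    ∃ C : ℝ≥0∞, C ≠ ⊤ ∧ ∀ f : ℝ × ℝ → ℂ, StronglyMeasurable f → Integrable f →
      ∫⁻ ξ, ‖f ξ‖ₑ ^ (st / (st - 1)) ≤ 1 → ∫⁻ p, ‖extOp f p‖ₑ ^ (2 * st) ≤ C := by
  set P := st / (st - 1) with hP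
  have hst1 : 0 < st - 1 := by linarith
  have hPd : P - 1 = 1 / (st - 1) := by rw [hP]; field_simp; ring
  have hδ : 0 < P - 1 := by rw [hPd]; positivity
  have hP0 : 0 < P := by linarith
  obtain ⟨C₁, hC₁, h1⟩ := ptw (P - 1) (2 * s) (2 * st) hδ (by linarith) (by linarith)
  refine ⟨C₁ * (C₀ * pw (2 * s)), ENNReal.mul_ne_top hC₁ (ENNReal.mul_ne_top hC₀ (pw_ne_top _)), ?_⟩
  intro f hfm hf hle
  have hsum := (level_sum hfm P hP0).trans hle
  set a : ℤ → ℝ≥0∞ := fun n => pw (n * P) * volume (lev f n) with ha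
  have ha1 : ∀ n, a n ≤ 1 := fun n => (ENNReal.le_tsum n).trans hsum
  have hV : ∀ n : ℤ, volume (lev f n) = pw (-(n * P)) * a n := by
    intro n
    rw [ha]
    simp only
    rw [← mul_assoc, mul_comm (pw _) (pw _), pw_mul_neg, one_mul]
  have hVt : ∀ n, volume (lev f n) ≠ ⊤ := by
    intro n
    rw [hV]
    exact ENNReal.mul_ne_top (pw_ne_top _) (ne_top_of_le_ne_top (by norm_num) (ha1 n))
  have hInt : ∀ n, Integrable ((lev f n).indicator f) := fun n => hf.indicator (measurableSet_lev hfm n)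
  have hsup : ∀ p (n : ℤ), ‖extOp ((lev f n).indicator f) p‖ₑ ≤ 2 * pw (-n * (P - 1)) := by
    intro p n
    refine (enorm_extOp_le _ p).trans ?_
    simp_rw [enorm_indicator_eq_indicator_enorm]
    rw [lintegral_indicator (measurableSet_lev hfm n)]
    calc _ ≤ ∫⁻ ξ in lev f n, pw ((n:ℝ) + 1) :=
          setLIntegral_mono' (measurableSet_lev hfm n) fun ξ hξ => hξ.2.le
      _ = pw ((n:ℝ) + 1) * (pw (-(n * P)) * a n) := by rw [setLIntegral_const, hV]
      _ ≤ pw ((n:ℝ) + 1) * (pw (-(n * P)) * 1) := by gcongr; exact ha1 n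
      _ = _ := by
        rw [mul_one, ← pw_add, ← pw_one, ← pw_add]
        congr 1; ring
  have hL : ∀ n : ℤ, ∫⁻ p, ‖extOp ((lev f n).indicator f) p‖ₑ ^ (2 * s) ≤
      pw ((n + 1) * (2 * s)) * (C₀ * volume (lev f n) ^ (2 * (s - 1))) := by
    intro n
    set c : ℂ := (((2:ℝ) ^ (-((n:ℝ) + 1)) : ℝ) : ℂ) with hc
    have hcn : ‖c‖ = (2:ℝ) ^ (-((n:ℝ) + 1)) := by
      rw [hc, Complex.norm_real, Real.norm_of_nonneg (by positivity)]
    have hce : ‖c‖ₑ = pw (-((n:ℝ) + 1)) := by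
      rw [pw_eq_ofReal, ← hcn, ofReal_norm]
    have h := hD (c • (lev f n).indicator f) (lev f n) ((hInt n).smul c) (measurableSet_lev hfm n)
      (hVt n) (by
        intro ξ
        by_cases hξ : ξ ∈ lev f n
        · simp only [Pi.smul_apply, indicator_of_mem hξ, norm_smul, hcn]
          have h2 : ‖f ξ‖ ≤ (2:ℝ) ^ ((n:ℝ) + 1) := by
            have := hξ.2.le
            rw [pw_eq_ofReal, ← ofReal_norm] at this
            exact (ENNReal.ofReal_le_ofReal_iff (by positivity)).1 this
          calc _ ≤ (2:ℝ) ^ (-((n:ℝ) + 1)) * (2:ℝ) ^ ((n:ℝ) + 1) := by gcongr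
            _ = 1 := by rw [← Real.rpow_add (by norm_num)]; simp
        · simp [hξ])
    refine le_trans (le_of_eq ?_) (mul_le_mul' le_rfl h)
    rw [← lintegral_const_mul' _ _ (pw_ne_top _)]
    refine lintegral_congr fun p => ?_
    rw [extOp_const_smul, enorm_mul, hce, ENNReal.mul_rpow_of_nonneg _ _ (by linarith), pw_rpow,
      ← mul_assoc, ← pw_add]
    rw [show ((n:ℝ) + 1) * (2 * s) + -((n:ℝ) + 1) * (2 * s) = 0 by ring, pw_zero, one_mul]
  have hcov : ∀ᵐ ξ : ℝ × ℝ, f ξ ≠ 0 → ξ ∈ ⋃ n, lev f n := by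
    refine Filter.Eventually.of_forall fun ξ h => ?_
    obtain ⟨n, h1, h2⟩ := exists_pw (x := ‖f ξ‖ₑ) (by simpa using h) (by simp)
    exact mem_iUnion.2 ⟨n, h1, h2⟩
  have hmeas : ∀ n, Measurable fun p => ‖extOp ((lev f n).indicator f) p‖ₑ :=
    fun n => (continuous_enorm.comp (continuous_extOp (hInt n))).measurable
  calc ∫⁻ p, ‖extOp f p‖ₑ ^ (2 * st)
      ≤ ∫⁻ p, C₁ * ∑' n : ℤ, ‖extOp ((lev f n).indicator f) p‖ₑ ^ (2 * s) *
          pw (-n * ((P - 1) * (2 * st - 2 * s))) := by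
        refine lintegral_mono fun p => le_trans (ENNReal.rpow_le_rpow
          (enorm_extOp_le_tsum hf _ (measurableSet_lev hfm) (lev_disjoint f) hcov p) (by linarith)) ?_
        exact h1 _ (hsup p)
    _ = C₁ * ∑' n : ℤ, (∫⁻ p, ‖extOp ((lev f n).indicator f) p‖ₑ ^ (2 * s)) *
          pw (-n * ((P - 1) * (2 * st - 2 * s))) := by
        rw [lintegral_const_mul' _ _ hC₁, lintegral_tsum
          (fun n => (((hmeas n).pow_const _).mul_const _).aemeasurable)]
        congr 2
        ext n
        rw [lintegral_mul_const' _ _ (pw_ne_top _)]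
    _ ≤ C₁ * ∑' n : ℤ, C₀ * pw (2 * s) * a n ^ (2 * (s - 1)) := by
        refine mul_le_mul' le_rfl (ENNReal.tsum_le_tsum fun n => ?_)
        refine (mul_le_mul' (hL n) le_rfl).trans (le_of_eq ?_)
        rw [hV, ENNReal.mul_rpow_of_nonneg _ _ (by linarith), pw_rpow]
        have e : pw (2 * s) = pw ((n + 1) * (2 * s)) * pw (-(n * P) * (2 * (s - 1))) *
            pw (-n * ((P - 1) * (2 * st - 2 * s))) := by
          rw [← pw_add, ← pw_add]
          congr 1
          rw [hPd, hP]
          field_simp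
          ring
        rw [e]; ring
    _ = C₁ * (C₀ * pw (2 * s) * ∑' n : ℤ, a n ^ (2 * (s - 1))) := by rw [ENNReal.tsum_mul_left]
    _ ≤ C₁ * (C₀ * pw (2 * s) * 1) := by
        gcongr
        refine (tsum_rpow_le a _ (by linarith)).trans ?_
        exact ENNReal.rpow_le_one hsum (by linarith)
    _ = _ := by rw [mul_one]

lemma stepE (s st : ℝ) (hs1 : 3 / 2 < s) (hst : s < st) (C₀ : ℝ≥0∞) (hC₀ : C₀ ≠ ⊤)
    (hD : ∀ (f : ℝ × ℝ → ℂ) (Ω : Set (ℝ × ℝ)), Integrable f →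
      MeasurableSet Ω → volume Ω ≠ ⊤ → (∀ ξ, ‖f ξ‖ ≤ Ω.indicator (fun _ => (1:ℝ)) ξ) →
      ∫⁻ p, ‖extOp f p‖ₑ ^ (2 * s) ≤ C₀ * volume Ω ^ (2 * (s - 1))) :
    ∃ C : ℝ, 0 < C ∧
        ∀ f : ℝ × ℝ → ℂ, Integrable f volume →
          eLpNorm (extOp f) (ENNReal.ofReal (2 * st)) volume ≤
            ENNReal.ofReal C * eLpNorm f (ENNReal.ofReal (st / (st - 1))) volume := by
  obtain ⟨C, hC, h⟩ := stepE0 s st hs1 hst C₀ hC₀ hD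
  have hst1 : 0 < st - 1 := by linarith
  have hP0 : 0 < st / (st - 1) := div_pos (by linarith) hst1
  set P := st / (st - 1) with hP
  have hq0 : 0 < 2 * st := by linarith
  have conv : ∀ {α : Type} [MeasureSpace α] (g : α → ℂ) {x : ℝ}, 0 < x →
      eLpNorm g (ENNReal.ofReal x) volume = (∫⁻ y, ‖g y‖ₑ ^ x) ^ (1 / x) := by
    intro α _ g x hx
    rw [eLpNorm_eq_lintegral_rpow_enorm_toReal (by simpa using hx) (by simp), ENNReal.toReal_ofReal hx.le]
  have hCt : C ^ (1 / (2 * st)) ≠ ⊤ := ENNReal.rpow_ne_top_of_nonneg (by positivity) hC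
  refine ⟨(C ^ (1 / (2 * st))).toReal + 1, by positivity, ?_⟩
  have hCle : C ^ (1 / (2 * st)) ≤ ENNReal.ofReal ((C ^ (1 / (2 * st))).toReal + 1) := by
    rw [ENNReal.ofReal_add (by positivity) (by norm_num), ENNReal.ofReal_toReal hCt]
    exact le_self_add
  set C' := ENNReal.ofReal ((C ^ (1 / (2 * st))).toReal + 1) with hC'
  have hC'0 : C' ≠ 0 := by
    rw [hC']; simp only [ne_eq, ENNReal.ofReal_eq_zero, not_le]; positivity
  have main : ∀ f : ℝ × ℝ → ℂ, StronglyMeasurable f → Integrable f →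
      eLpNorm (extOp f) (ENNReal.ofReal (2 * st)) volume ≤ C' * eLpNorm f (ENNReal.ofReal P) volume := by
    intro f hfm hf
    set M := eLpNorm f (ENNReal.ofReal P) volume with hM
    by_cases hMt : M = ⊤
    · rw [hMt, ENNReal.mul_top hC'0]; exact le_top
    by_cases hM0 : M = 0
    · have h0 : f =ᵐ[volume] 0 := (eLpNorm_eq_zero_iff hf.1 (by simpa using hP0)).1 hM0
      have : extOp f = 0 := by
        rw [extOp_congr h0]; ext p; simp [extOp]
      rw [this]; simp
    set c : ℂ := ((M.toReal⁻¹ : ℝ) : ℂ) with hc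
    have hMp : 0 < M.toReal := ENNReal.toReal_pos hM0 hMt
    have hce : ‖c‖ₑ = M⁻¹ := by
      rw [hc, ← ofReal_norm, Complex.norm_real, Real.norm_of_nonneg (by positivity),
        ENNReal.ofReal_inv_of_pos hMp, ENNReal.ofReal_toReal hMt]
    have h1 : eLpNorm (c • f) (ENNReal.ofReal P) volume = 1 := by
      rw [eLpNorm_const_smul, hce, ← hM, ENNReal.inv_mul_cancel hM0 hMt]
    have h2 : ∫⁻ ξ, ‖(c • f) ξ‖ₑ ^ P ≤ 1 := by
      rw [conv _ hP0] at h1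
      by_contra hcon
      push Not at hcon
      have := ENNReal.one_lt_rpow hcon (one_div_pos.2 hP0)
      exact this.ne' h1
    have h3 := h (c • f) (hfm.const_smul c) (hf.smul c) h2
    have h4 : eLpNorm (extOp (c • f)) (ENNReal.ofReal (2 * st)) volume ≤ C' := by
      rw [conv _ hq0]
      exact (ENNReal.rpow_le_rpow h3 (by positivity)).trans hCle
    have h5 : extOp (c • f) = c • extOp f := by
      ext p; rw [extOp_const_smul]; rfl
    rw [h5, eLpNorm_const_smul, hce] at h4
    calc _ = M⁻¹ * eLpNorm (extOp f) (ENNReal.ofReal (2 * st)) volume * M := by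
          rw [mul_right_comm, ENNReal.inv_mul_cancel hM0 hMt, one_mul]
      _ ≤ _ := mul_le_mul' h4 le_rfl
  intro f hf
  have he := hf.1.ae_eq_mk
  have := main (hf.1.mk f) hf.1.stronglyMeasurable_mk (hf.congr he)
  rwa [← extOp_congr he, ← eLpNorm_congr_ae he] at this

/-- if BH(s,r) holds for some `3/2 < s < 2` and `r < s'`, then for every `s̃ > s`
the operator `𝓔` is bounded from `L^{s̃'}(ℝ²)` to `L^{2s̃}(ℝ³)`, in the sense that
`∥𝓔f∥_{L^{2s̃}} ≤ C ∥f∥_{L^{s̃'}}` on the dense class of integrable `f` (the estimate then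
extends by density). -/
theorem stmt1 (s r A : ℝ) (hs₁ : 3 / 2 < s) (hs₂ : s < 2) (hr : r < s / (s - 1))
    (hBH : BH s r A) :
    ∀ st : ℝ, s < st →
      ∃ C : ℝ, 0 < C ∧
        ∀ f : ℝ × ℝ → ℂ, Integrable f volume →
          eLpNorm (extOp f) (ENNReal.ofReal (2 * st)) volume ≤
            ENNReal.ofReal C * eLpNorm f (ENNReal.ofReal (st / (st - 1))) volume := by
  intro st hst
  have hs0 : 0 < s - 1 := by linarith
  have hsp : 1 < s / (s - 1) := by rw [lt_div_iff₀ hs0]; linarith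
  obtain ⟨r1, hr1, hr2⟩ := exists_between (max_lt hr hsp)
  have hrr : r < r1 := (le_max_left _ _).trans_lt hr1
  have hr10 : 0 < r1 := lt_trans one_pos ((le_max_right _ _).trans_lt hr1)
  have hρ : s - 1 < s / r1 := by
    rw [lt_div_iff₀ hr10]
    rw [lt_div_iff₀ hs0] at hr2
    linarith
  have hγ : 0 < min (2 * s - 3) (2 * (s / r1) - 2 * s + 2) := lt_min (by linarith) (by linarith)
  obtain ⟨C₀, hC₀, hD⟩ := stepD s r r1 A (min (2 * s - 3) (2 * (s / r1) - 2 * s + 2)) hs₁ hs₂.le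
    hr10 hrr.le hBH (by linarith) hγ (min_le_left _ _) (min_le_right _ _)
  exact stepE s st hs₁ hst C₀ hC₀ hD
end

section
/- Assume BH(s,r) holds for some 3/2 < s < 2 and r < s'. Then there is a constant C such that for all integers j, k ≥ 0 and all f, g ∈ L^r(ℝ²) supported on 2^{-j} × 2^{-k} tiles τ, τ' ∈ 𝓓_{j,k} whose horizontal projections are separated by a distance between 2^{-j} and 4·2^{-j} and whose vertical projections are separated by a distance between 2^{-k} and 4·2^{-k}, one has ∥𝓔f·𝓔g∥_{L^s(ℝ³)} ≤ C · 2^{-(j+k)(2 − 2/s − 2/r)} ∥f∥_{L^r} ∥g∥_{L^r}. -/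
open MeasureTheory Set

/-- The dyadic interval `[m·2⁻ⁿ, (m+1)·2⁻ⁿ]`. -/
def dyadicIcc (n m : ℤ) : Set ℝ := Icc ((m : ℝ) * 2 ^ (-n)) (((m : ℝ) + 1) * 2 ^ (-n))

/-- A tile in `𝓓_{j,k}`: a product of a dyadic interval of length `2⁻ʲ` with one of
length `2⁻ᵏ`. -/
def tile (j k m m' : ℤ) : Set (ℝ × ℝ) := dyadicIcc j m ×ˢ dyadicIcc k m'

/-- A dyadic number is one of the form `2ⁿ`, `n ∈ ℤ`. -/
def IsDyadic (x : ℝ) : Prop := ∃ n : ℤ, x = 2 ^ n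

lemma map_mul_vol (a : ℝ) (ha : 0 < a) :
    Measure.map (fun x : ℝ => a * x) volume = ENNReal.ofReal a⁻¹ • volume := by
  rw [Real.map_volume_mul_left ha.ne', abs_of_pos (inv_pos.2 ha)]

lemma emb_mul (a : ℝ) (ha : 0 < a) : MeasurableEmbedding (fun x : ℝ => a * x) :=
  (Homeomorph.mulLeft₀ a ha.ne').measurableEmbedding

lemma emb2 (a b : ℝ) (ha : 0 < a) (hb : 0 < b) :
    MeasurableEmbedding (Prod.map (fun x : ℝ => a * x) (fun x : ℝ => b * x)) :=
  (emb_mul a ha).prodMap (emb_mul b hb)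

lemma emb3 (c a b : ℝ) (hc : 0 < c) (ha : 0 < a) (hb : 0 < b) :
    MeasurableEmbedding (Prod.map (fun x : ℝ => c * x)
      (Prod.map (fun x : ℝ => a * x) (fun x : ℝ => b * x))) :=
  (emb_mul c hc).prodMap (emb2 a b ha hb)

lemma map2 (a b : ℝ) (ha : 0 < a) (hb : 0 < b) :
    Measure.map (Prod.map (fun x : ℝ => a * x) (fun x : ℝ => b * x)) volume
      = ENNReal.ofReal (a * b)⁻¹ • (volume : Measure (ℝ × ℝ)) := by
  rw [Measure.volume_eq_prod, ← Measure.map_prod_map _ _ (by fun_prop) (by fun_prop),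
    map_mul_vol a ha, map_mul_vol b hb, Measure.prod_smul_left, Measure.prod_smul_right, smul_smul,
    ← ENNReal.ofReal_mul (inv_pos.2 ha).le, mul_inv]

lemma map3 (c a b : ℝ) (hc : 0 < c) (ha : 0 < a) (hb : 0 < b) :
    Measure.map (Prod.map (fun x : ℝ => c * x)
      (Prod.map (fun x : ℝ => a * x) (fun x : ℝ => b * x))) volume
      = ENNReal.ofReal (c * (a * b))⁻¹ • (volume : Measure (ℝ × ℝ × ℝ)) := by
  rw [Measure.volume_eq_prod,
    ← Measure.map_prod_map _ _ (by fun_prop) (emb2 a b ha hb).measurable,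
    map_mul_vol c hc, map2 a b ha hb, Measure.prod_smul_left, Measure.prod_smul_right, smul_smul,
    ← ENNReal.ofReal_mul (inv_pos.2 hc).le, mul_inv c]

lemma extOp_scale (a b : ℝ) (ha : 0 < a) (hb : 0 < b) (f : ℝ × ℝ → ℂ) (p : ℝ × ℝ × ℝ) :
    extOp f p = ((a * b : ℝ) : ℂ) *
      extOp (f ∘ Prod.map (fun x : ℝ => a * x) (fun x : ℝ => b * x))
        (Prod.map (fun x : ℝ => (a * b) * x)
          (Prod.map (fun x : ℝ => a * x) (fun x : ℝ => b * x)) p) := by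
  have hab : 0 < a * b := mul_pos ha hb
  have h := (emb2 a b ha hb).integral_map (μ := volume) (fun ξ : ℝ × ℝ =>
    Complex.exp (Complex.I * (p.1 * ξ.1 * ξ.2 + p.2.1 * ξ.1 + p.2.2 * ξ.2 : ℝ)) * f ξ)
  rw [map2 a b ha hb, integral_smul_measure, ENNReal.toReal_ofReal (inv_pos.2 hab).le] at h
  have h2 : extOp f p = (a * b) • ((a * b)⁻¹ • extOp f p) := by
    rw [smul_smul, mul_inv_cancel₀ hab.ne', one_smul]
  rw [h2]
  unfold extOp
  rw [h, Complex.real_smul]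
  congr 1
  refine integral_congr_ae (Filter.Eventually.of_forall fun ξ => ?_)
  simp only [Prod.map_fst, Prod.map_snd, Function.comp]
  congr 4
  ring

lemma eLpNorm_comp_scale {α : Type*} [MeasurableSpace α] {μ : Measure α} {e : α → α}
    (he : MeasurableEmbedding e) (c : ℝ) (hc : 0 < c)
    (hm : Measure.map e μ = ENNReal.ofReal c⁻¹ • μ) (q : ℝ) (hq : 0 < q) (F : α → ℂ) :
    eLpNorm (F ∘ e) (ENNReal.ofReal q) μ
      = ENNReal.ofReal (c ^ (-(1 / q))) * eLpNorm F (ENNReal.ofReal q) μ := by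
  rw [← he.eLpNorm_map_measure, hm, eLpNorm_smul_measure_of_ne_top ENNReal.ofReal_ne_top,
    smul_eq_mul, ENNReal.toReal_div, ENNReal.toReal_one, ENNReal.toReal_ofReal hq.le,
    ENNReal.ofReal_rpow_of_pos (inv_pos.2 hc), Real.inv_rpow hc.le, Real.rpow_neg hc.le]

lemma supp_scale (j k : ℕ) (m m' : ℤ) (f : ℝ × ℝ → ℂ)
    (h : Function.support f ⊆ tile (j : ℤ) (k : ℤ) m m') :
    Function.support (f ∘ Prod.map (fun x : ℝ => (2 : ℝ) ^ (-(j : ℤ)) * x)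
      (fun x : ℝ => (2 : ℝ) ^ (-(k : ℤ)) * x)) ⊆ unitSq m m' := by
  intro x hx
  have hx' := h (show Prod.map (fun x : ℝ => (2 : ℝ) ^ (-(j : ℤ)) * x)
      (fun x : ℝ => (2 : ℝ) ^ (-(k : ℤ)) * x) x ∈ Function.support f from hx)
  have ha : (0 : ℝ) < 2 ^ (-(j : ℤ)) := by positivity
  have hb : (0 : ℝ) < 2 ^ (-(k : ℤ)) := by positivity
  simp only [tile, dyadicIcc, Set.mem_prod, Set.mem_Icc, Prod.map_fst, Prod.map_snd] at hx'
  simp only [unitSq, Set.mem_prod, Set.mem_Icc]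
  obtain ⟨⟨h1, h2⟩, h3, h4⟩ := hx'
  rw [mul_comm] at h1 h3
  rw [mul_comm (_ + 1)] at h2 h4
  exact ⟨⟨le_of_mul_le_mul_left h1 ha, le_of_mul_le_mul_left h2 ha⟩,
    le_of_mul_le_mul_left h3 hb, le_of_mul_le_mul_left h4 hb⟩

/-- the rescaled bilinear estimate.  Under BH(s,r) with `3/2 < s < 2`, `r < s'`,
for `f, g` supported on `2⁻ʲ × 2⁻ᵏ` tiles of `𝓓_{j,k}` whose horizontal projections are
separated by a distance between `2⁻ʲ` and `4·2⁻ʲ` (i.e. `2 ≤ |m - n| ≤ 5`) and whose vertical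
projections are separated by a distance between `2⁻ᵏ` and `4·2⁻ᵏ` (i.e. `2 ≤ |m' - n'| ≤ 5`),
one has `∥𝓔f·𝓔g∥_{L^s} ≤ C 2^{-(j+k)(2 - 2/s - 2/r)} ∥f∥_{L^r} ∥g∥_{L^r}`. -/
theorem stmt3 (s r A : ℝ) (hs₁ : 3 / 2 < s) (hs₂ : s < 2) (hr : r < s / (s - 1))
    (hBH : BH s r A) :
    ∃ C : ℝ, 0 < C ∧
      ∀ (j k : ℕ) (m m' n n' : ℤ) (f g : ℝ × ℝ → ℂ),
        2 ≤ |m - n| → |m - n| ≤ 5 → 2 ≤ |m' - n'| → |m' - n'| ≤ 5 →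
        Function.support f ⊆ tile (j : ℤ) (k : ℤ) m m' →
        Function.support g ⊆ tile (j : ℤ) (k : ℤ) n n' →
        eLpNorm (fun p => extOp f p * extOp g p) (ENNReal.ofReal s) volume ≤
          ENNReal.ofReal (C * 2 ^ (-((j : ℝ) + (k : ℝ)) * (2 - 2 / s - 2 / r))) *
            eLpNorm f (ENNReal.ofReal r) volume * eLpNorm g (ENNReal.ofReal r) volume := by
  refine ⟨|A| + 1, by positivity, ?_⟩
  intro j k m m' n n' f g h1 h2 h3 h4 hf hg
  have hs : 0 < s := by linarith
  set a : ℝ := (2 : ℝ) ^ (-(j : ℤ)) with ha_def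
  set b : ℝ := (2 : ℝ) ^ (-(k : ℤ)) with hb_def
  have ha : 0 < a := by positivity
  have hb : 0 < b := by positivity
  have hab : 0 < a * b := mul_pos ha hb
  set e := Prod.map (fun x : ℝ => a * x) (fun x : ℝ => b * x) with he
  have key := hBH m m' n n' (by exact_mod_cast h1) (by exact_mod_cast h2)
    (by exact_mod_cast h3) (by exact_mod_cast h4) (f ∘ e) (g ∘ e)
    (supp_scale j k m m' f hf) (supp_scale j k n n' g hg)
  have hL : eLpNorm (fun p => extOp f p * extOp g p) (ENNReal.ofReal s) volume
      = ENNReal.ofReal ((a * b) ^ (2 - 2 / s)) *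
        eLpNorm (fun p => extOp (f ∘ e) p * extOp (g ∘ e) p) (ENNReal.ofReal s) volume := by
    have hfun : (fun p => extOp f p * extOp g p) = (((a * b) ^ 2 : ℝ) : ℂ) •
        ((fun p => extOp (f ∘ e) p * extOp (g ∘ e) p) ∘ Prod.map (fun x : ℝ => (a * b) * x)
          (Prod.map (fun x : ℝ => a * x) (fun x : ℝ => b * x))) := by
      funext p
      rw [extOp_scale a b ha hb f p, extOp_scale a b ha hb g p]
      simp only [Pi.smul_apply, smul_eq_mul, Function.comp_apply]
      push_cast
      ring
    rw [hfun, eLpNorm_const_smul,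
      eLpNorm_comp_scale (emb3 (a * b) a b hab ha hb) (a * b * (a * b)) (by positivity)
        (map3 (a * b) a b hab ha hb) s hs, ← mul_assoc]
    congr 1
    rw [← ofReal_norm_eq_enorm, Complex.norm_real, Real.norm_of_nonneg (by positivity),
      ← ENNReal.ofReal_mul (by positivity)]
    congr 1
    rw [← pow_two, ← Real.rpow_natCast, ← Real.rpow_mul hab.le, ← Real.rpow_add hab]
    congr 1
    push_cast
    ring
  rw [hL]
  rcases le_or_gt r 0 with hr0 | hr0
  · rw [ENNReal.ofReal_of_nonpos hr0] at key ⊢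
    simp only [eLpNorm_exponent_zero, mul_zero, nonpos_iff_eq_zero] at key ⊢
    rw [key, mul_zero]
  · have hmap := map2 a b ha hb
    rw [eLpNorm_comp_scale (emb2 a b ha hb) (a * b) hab hmap r hr0 f,
      eLpNorm_comp_scale (emb2 a b ha hb) (a * b) hab hmap r hr0 g] at key
    have hexp : (2 : ℝ) ^ (-((j : ℝ) + (k : ℝ)) * (2 - 2 / s - 2 / r))
        = (a * b) ^ (2 - 2 / s) * ((a * b) ^ (-(1 / r)) * (a * b) ^ (-(1 / r))) := by
      have hab2 : a * b = (2 : ℝ) ^ (-((j : ℝ) + (k : ℝ))) := by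
        rw [ha_def, hb_def, ← Real.rpow_intCast, ← Real.rpow_intCast,
          ← Real.rpow_add two_pos]
        congr 1
        push_cast
        ring
      rw [← Real.rpow_add hab, ← Real.rpow_add hab, hab2, ← Real.rpow_mul two_pos.le]
      congr 1
      ring
    have hA : ENNReal.ofReal A ≤ ENNReal.ofReal (|A| + 1) :=
      ENNReal.ofReal_le_ofReal (by linarith [le_abs_self A])
    rw [hexp, ENNReal.ofReal_mul (by positivity), ENNReal.ofReal_mul (by positivity),
      ENNReal.ofReal_mul (by positivity)]
    calc _ ≤ _ := mul_le_mul_right key _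
      _ ≤ _ := mul_le_mul_right (mul_le_mul_left (mul_le_mul_left hA _) _) _
      _ = _ := by ring
end
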